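/- arXiv:2112.01133 — 6 statements merged into one kernel-verified Lean document; each statement's English description precedes it below -/
import Mathlib

section
/- Let K be the number field defined by an irreducible trinomial x^5 + a x^2 + b with a odd, ν_2(b) = 2k for some positive integer k, and b/2^{ν_2(b)} + a ≡ 0 (mod 4). Then 2 is a common index divisor of K and K is not monogenic. -/
open Polynomial NumberField

noncomputable def subIndex {K : Type*} [Field K] [NumberField K] (θ : 𝓞 K) : ℕ :=
  (Algebra.adjoin ℤ ({θ} : Set (𝓞 K))).toSubring.toAddSubgroup.index

def IsCommonIndexDivisor (p : ℕ) (K : Type*) [Field K] [NumberField K] : Prop :=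
  ∀ θ : 𝓞 K, Algebra.adjoin ℚ ({(θ : K)} : Set K) = ⊤ → p ∣ subIndex θ

def IsMonogenic (K : Type*) [Field K] [NumberField K] : Prop :=
  ∃ θ : 𝓞 K, Algebra.adjoin ℤ ({θ} : Set (𝓞 K)) = ⊤

/-- More ring homomorphisms to a field of characteristic `p` than this field has elements
force `p` to divide the index of every `ℤ[θ]`. -/
theorem dvd_subIndex_of_injective {K : Type*} [Field K] [NumberField K] {L ι : Type*} [Field L]
    [Finite L] (p : ℕ) [Fact p.Prime] [CharP L p] [Finite ι] (Φ : ι → (𝓞 K →+* L))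
    (hΦ : Function.Injective Φ) (hcard : Nat.card L < Nat.card ι) (θ : 𝓞 K) :
    p ∣ subIndex θ := by
  by_contra hp
  have := Fintype.ofFinite L
  have := Fintype.ofFinite ι
  rw [Nat.card_eq_fintype_card, Nat.card_eq_fintype_card] at hcard
  obtain ⟨i, j, hij, h⟩ := Fintype.exists_ne_map_eq_of_card_lt (fun i => Φ i θ) hcard
  refine hij (hΦ (RingHom.ext fun x => ?_))
  have hagree : ∀ y ∈ Algebra.adjoin ℤ ({θ} : Set (𝓞 K)), Φ i y = Φ j y := by
    intro y hy
    induction hy using Algebra.adjoin_induction with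
    | mem x hx => rw [Set.mem_singleton_iff.1 hx]; exact h
    | algebraMap r => simp
    | add x y _ _ hx hy => rw [map_add, map_add, hx, hy]
    | mul x y _ _ hx hy => rw [map_mul, map_mul, hx, hy]
  have hmem := hagree _ ((Algebra.adjoin ℤ
    ({θ} : Set (𝓞 K))).toSubring.toAddSubgroup.nsmul_index_mem x)
  change Φ i (subIndex θ • x) = Φ j (subIndex θ • x) at hmem
  rw [map_nsmul, map_nsmul, nsmul_eq_mul, nsmul_eq_mul] at hmem
  exact mul_left_cancel₀ (fun h0 => hp ((CharP.cast_eq_zero_iff L p _).1 h0)) hmem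

/-- A root of the minimal polynomial of a generator of `K` in an integrally closed domain of
characteristic zero determines a homomorphism from the ring of integers. -/
theorem exists_ringHom_of_root {K : Type*} [Field K] [NumberField K] {W : Type*} [CommRing W]
    [IsDomain W] [CharZero W] [IsIntegrallyClosed W] (f : ℤ[X])
    (hirr : Irreducible (f.map (algebraMap ℤ ℚ))) (α : 𝓞 K) (hα : aeval α f = 0)
    (hgen : Algebra.adjoin ℚ ({(α : K)} : Set K) = ⊤) (F : Type*) [Field F] [Algebra W F]
    [IsFractionRing W F] (r : W) (hr : aeval r f = 0) :
    ∃ ψ : 𝓞 K →+* W, ψ α = r := by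
  have : CharZero F := charZero_of_injective_algebraMap (IsFractionRing.injective W F)
  have hint : IsIntegral ℚ (α : K) := Algebra.IsIntegral.isIntegral _
  let pb := PowerBasis.ofAdjoinEqTop' hint hgen
  have hpb : pb.gen = (α : K) := PowerBasis.ofAdjoinEqTop'_gen hint hgen
  have hαK : aeval (α : K) (f.map (algebraMap ℤ ℚ)) = 0 := by
    rw [aeval_map_algebraMap, aeval_algebraMap_apply, hα, map_zero]
  have hrF : aeval (algebraMap W F r) (minpoly ℚ pb.gen) = 0 := by
    rw [hpb, ← minpoly.eq_of_irreducible hirr hαK, map_mul, aeval_map_algebraMap,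
      aeval_algebraMap_apply, hr, map_zero, zero_mul]
  let ι : K →ₐ[ℚ] F := pb.lift _ hrF
  have hι : ι (α : K) = algebraMap W F r := by
    rw [← hpb]; exact pb.lift_gen _ hrF
  have hex : ∀ x : 𝓞 K, ∃ w : W, algebraMap W F w = ι x := fun x => by
    have hx : IsIntegral ℤ (ι (x : K)) := x.isIntegral_coe.map ι
    exact IsIntegrallyClosed.isIntegral_iff.1 hx.tower_top
  choose ψ hψ using hex
  have hinj := IsFractionRing.injective W F
  refine ⟨⟨⟨⟨ψ, ?_⟩, ?_⟩, ?_, ?_⟩, ?_⟩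
  · exact hinj (by simp [hψ])
  · exact fun x y => hinj (by simp [hψ])
  · exact hinj (by simp [hψ])
  · exact fun x y => hinj (by simp [hψ])
  · exact hinj (by simp [hψ, hι])

/-- A nonmonic form of Hensel's lemma, for quintics with small constant coefficient. -/
theorem HenselianRing.exists_root_quintic {R : Type*} [CommRing R] (I : Ideal R) [HenselianRing R I]
    (c u t₂ t₃ t₄ t₅ : R) (hc : c ∈ I) (hu : IsUnit u) :
    ∃ z ∈ I, c + u * z + t₂ * z ^ 2 + t₃ * z ^ 3 + t₄ * z ^ 4 + t₅ * z ^ 5 = 0 := by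
  let P : R[X] := X ^ 5 + C u * X ^ 4 + C (t₂ * c) * X ^ 3 + C (t₃ * c ^ 2) * X ^ 2 +
    C (t₄ * c ^ 3) * X + C (t₅ * c ^ 4)
  have hP : P.Monic := by
    unfold P
    monicity!
  have hc0 : Ideal.Quotient.mk I c = 0 := Ideal.Quotient.eq_zero_iff_mem.2 hc
  have hroot : P.eval (-u) ∈ I := by
    rw [← Ideal.Quotient.eq_zero_iff_mem]
    simp [P, hc0]
    ring
  have hder : IsUnit (Ideal.Quotient.mk I (P.derivative.eval (-u))) := by
    have : Ideal.Quotient.mk I (P.derivative.eval (-u)) = Ideal.Quotient.mk I (u ^ 4) := by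
      simp only [P, derivative_add, derivative_mul, derivative_C, derivative_X_pow, derivative_X]
      simp [hc0, map_ofNat (Ideal.Quotient.mk I)]
      ring
    rw [this]
    exact (hu.pow 4).map _
  obtain ⟨t, ht, htu⟩ := HenselianRing.is_henselian P hP (-u) hroot hder
  have htunit : IsUnit t := by
    have := isLocalHom_of_le_jacobson_bot I HenselianRing.jac
    refine IsUnit.of_map (Ideal.Quotient.mk I) t ?_
    rw [Ideal.Quotient.eq.2 htu]
    exact hu.neg.map _
  obtain ⟨s, hs⟩ := htunit.exists_right_inv
  refine ⟨c * s, I.mul_mem_right _ hc, ?_⟩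
  have ht' : t ^ 5 + u * t ^ 4 + t₂ * c * t ^ 3 + t₃ * c ^ 2 * t ^ 2 + t₄ * c ^ 3 * t +
      t₅ * c ^ 4 = 0 := by
    simpa [P] using ht
  have hst (i : ℕ) (j : ℕ) : s ^ (i + j) * t ^ j = s ^ i := by
    rw [pow_add, mul_assoc, ← mul_pow, mul_comm s t, hs, one_pow, mul_one]
  linear_combination c * s ^ 5 * ht' - c * hst 0 5 - c * u * hst 1 4 - c ^ 2 * t₂ * hst 2 3 -
    c ^ 3 * t₃ * hst 3 2 - c ^ 4 * t₄ * hst 4 1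

namespace WittVector

variable {p : ℕ} [Fact p.Prime] {F : Type*}

instance charZero_of_perfectField [Field F] [CharP F p] [PerfectRing F p] :
    CharZero (WittVector p F) := by
  rcases CharP.exists (WittVector p F) with ⟨q, hq⟩
  rcases CharP.char_is_prime_or_zero (WittVector p F) q with hq' | rfl
  · have hF : ((q : ℕ) : F) = 0 := by
      rw [← map_natCast (constantCoeff (p := p) (R := F)), CharP.cast_eq_zero, map_zero]
    have hpq := (Nat.prime_dvd_prime_iff_eq Fact.out hq').1 ((CharP.cast_eq_zero_iff F p q).1 hF)
    subst hpq
    exact absurd (CharP.cast_eq_zero (WittVector p F) p) (irreducible p (k := F)).ne_zero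
  · exact CharP.charP_to_charZero _

/-- Simple roots of quintics over the residue field lift to Witt vectors. -/
theorem exists_root_of_residue_root [Field F] [CharP F p] [PerfectRing F p]
    (f : (WittVector p F)[X]) (hf : f.natDegree ≤ 5) (x : F)
    (hx : (f.map constantCoeff).eval x = 0) (hx' : (f.map constantCoeff).derivative.eval x ≠ 0) :
    ∃ r : WittVector p F, f.eval r = 0 ∧ constantCoeff r = x := by
  obtain ⟨r₀, rfl⟩ := constantCoeff_surjective (p := p) x
  have h0 : f.eval r₀ ∈ Ideal.span {(p : WittVector p F)} := by
    rw [eval_map, eval₂_hom] at hx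
    rwa [← ker_constantCoeff, RingHom.mem_ker]
  have hu : IsUnit (f.derivative.eval r₀) := by
    rw [derivative_map, eval_map, eval₂_hom] at hx'
    exact isUnit_of_coeff_zero_ne_zero _ hx'
  have hT := fun z => (taylor_eval r₀ f z)
  obtain ⟨z, hz, hz0⟩ := HenselianRing.exists_root_quintic _ (f.eval r₀) (f.derivative.eval r₀)
    ((taylor r₀ f).coeff 2) ((taylor r₀ f).coeff 3) ((taylor r₀ f).coeff 4)
    ((taylor r₀ f).coeff 5) h0 hu
  refine ⟨z + r₀, ?_, ?_⟩
  · rw [← hT, eval_eq_sum_range' (n := 6) (by rw [natDegree_taylor]; omega)]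
    simpa [Finset.sum_range_succ, taylor_coeff_one] using hz0
  · rw [← ker_constantCoeff, RingHom.mem_ker] at hz
    rw [map_add, hz, zero_add]

end WittVector

/-- The solutions `w` below correspond to the roots `-2 ^ k * c / (1 + 2 * w)` of
`X ^ 5 + a * X ^ 2 + 2 ^ (2 * k) * c`. -/
theorem WittVector.exists_root_of_sq_add_eq {F : Type*} [Field F] [CharP F 2] [PerfectRing F 2]
    (m n : ℤ) (y : F) (hy : y ^ 2 + y = m) :
    ∃ w : WittVector 2 F, (1 + 2 * w) ^ 3 * (w ^ 2 + w - m) = 2 * n ∧ constantCoeff w = y := by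
  have h2 : (2 : F) = 0 := CharTwo.two_eq_zero
  let Q : (WittVector 2 F)[X] := (1 + 2 * X) ^ 3 * (X ^ 2 + X - C (m : WittVector 2 F)) -
    C (2 * (n : WittVector 2 F))
  have hQ : Q.map constantCoeff = X ^ 2 + X - C (m : F) := by
    have h2' : (2 : F[X]) = 0 := by rw [← C_ofNat, h2, C_0]
    simp only [Q, Polynomial.map_sub, Polynomial.map_mul, Polynomial.map_add, Polynomial.map_pow,
      Polynomial.map_one, Polynomial.map_ofNat, map_X, map_mul, map_ofNat, map_intCast, h2']
    simp
  obtain ⟨w, hw, hwy⟩ := exists_root_of_residue_root Q (by unfold Q; compute_degree) y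
    (by rw [hQ]; simp [hy]) (by rw [hQ]; simp [h2, one_add_one_eq_two])
  refine ⟨w, ?_, hwy⟩
  simpa [Q, sub_eq_zero] using hw

theorem WittVector.exists_root_of_two_dvd {F : Type*} [Field F] [CharP F 2] [PerfectRing F 2]
    (a b c m : ℤ) (j : ℕ) (hb : b = 2 ^ (2 * (j + 1)) * c) (hm : -(a * c) = 1 + 4 * m) (y : F)
    (hy : y ^ 2 + y = m) :
    ∃ r w : WittVector 2 F, r ^ 5 + a * r ^ 2 + b = 0 ∧ (1 + 2 * w) * r = -(2 ^ (j + 1) * c) ∧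
      constantCoeff w = y ∧ constantCoeff r = 0 := by
  have h2 : (2 : F) = 0 := CharTwo.two_eq_zero
  obtain ⟨w, hw, hwy⟩ := exists_root_of_sq_add_eq m (2 ^ (3 * j) * c ^ 4) y hy
  have hmW : -(a * c : WittVector 2 F) = 1 + 4 * m :=
    mod_cast congrArg (Int.cast (R := WittVector 2 F)) hm
  have hunit : IsUnit (1 + 2 * w) := by
    refine isUnit_of_coeff_zero_ne_zero _ ?_
    change constantCoeff (1 + 2 * w) ≠ 0
    rw [map_add, map_mul, map_ofNat, h2, zero_mul, add_zero, map_one]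
    exact one_ne_zero
  obtain ⟨s, hs⟩ := hunit.exists_right_inv
  have hrw : (1 + 2 * w) * (-(2 ^ (j + 1) * c) * s) = -(2 ^ (j + 1) * c) := by
    linear_combination -(2 ^ (j + 1) * c : WittVector 2 F) * hs
  refine ⟨-(2 ^ (j + 1) * c) * s, w, ?_, hrw, hwy, by
    rw [map_mul, map_neg, map_mul, map_pow, map_ofNat, h2, zero_pow j.succ_ne_zero, zero_mul,
      neg_zero, zero_mul]⟩
  generalize -(2 ^ (j + 1) * c) * s = r at hrw
  refine (hunit.pow 5).mul_left_cancel ?_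
  have : (1 + 2 * w) ^ 5 * (r ^ 5 + a * r ^ 2 + b) = ((1 + 2 * w) * r) ^ 5 +
    a * (1 + 2 * w) ^ 3 * ((1 + 2 * w) * r) ^ 2 + b * (1 + 2 * w) ^ 5 := by ring
  rw [this, hrw, hb]
  push_cast at hw ⊢
  linear_combination (2 ^ (2 * (j + 1)) * c : WittVector 2 F) * (4 * hw - (1 + 2 * w) ^ 3 * hmW)

theorem WittVector.exists_root_of_pow_three_eq_one {F : Type*} [Field F] [CharP F 2]
    [PerfectRing F 2] (a b : ℤ) (ha : Odd a) (hb : Even b) (x : F) (hx : x ^ 3 = 1) :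
    ∃ r : WittVector 2 F, r ^ 5 + a * r ^ 2 + b = 0 ∧ constantCoeff r = x := by
  have h2 : (2 : F) = 0 := CharTwo.two_eq_zero
  have haF : (a : F) = 1 := by
    obtain ⟨d, rfl⟩ := ha
    simp [h2]
  have hbF : (b : F) = 0 := by
    obtain ⟨d, rfl⟩ := hb
    simp [← two_mul, h2]
  have hx0 : x ≠ 0 := by
    rintro rfl
    simp at hx
  let f : (WittVector 2 F)[X] := X ^ 5 + C (a : WittVector 2 F) * X ^ 2 + C (b : WittVector 2 F)
  have hf : f.map constantCoeff = X ^ 5 + X ^ 2 := by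
    have : f.map constantCoeff = X ^ 5 + C (a : F) * X ^ 2 + C (b : F) := by simp [f]
    rw [this, haF, hbF, C_1, C_0, one_mul, add_zero]
  obtain ⟨r, hr, hrx⟩ := exists_root_of_residue_root f (by unfold f; compute_degree) x
    (by rw [hf]; simp only [eval_add, eval_pow, eval_X]; linear_combination x ^ 2 * hx + x ^ 2 * h2)
    (by
      rw [hf]
      have : Polynomial.eval x (derivative (X ^ 5 + X ^ 2 : F[X])) = x ^ 4 := by
        simp
        linear_combination (2 * x ^ 4 + x) * h2
      rw [this]
      exact pow_ne_zero 4 hx0)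
  exact ⟨r, by simpa [f] using hr, hrx⟩

theorem GaloisField.pow_three_eq_one {x : GaloisField 2 2} (hx : x ≠ 0) : x ^ 3 = 1 := by
  have := Fintype.ofFinite (GaloisField 2 2)
  have h := FiniteField.pow_card_sub_one_eq_one x hx
  rwa [← Nat.card_eq_fintype_card, GaloisField.card 2 2 two_ne_zero] at h

theorem GaloisField.exists_sq_add_eq_intCast (m : ℤ) : ∃ y : GaloisField 2 2, y ^ 2 + y = m := by
  have h2 : (2 : GaloisField 2 2) = 0 := CharTwo.two_eq_zero
  obtain ⟨d, rfl⟩ | ⟨d, rfl⟩ := m.even_or_odd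
  · exact ⟨0, by simp [← two_mul, h2]⟩
  · have := Fintype.ofFinite (GaloisField 2 2)
    classical
    obtain ⟨x, hx⟩ : ∃ x : GaloisField 2 2, x ∉ ({0, 1} : Finset (GaloisField 2 2)) := by
      by_contra! h
      have h1 := Finset.card_le_card (fun x _ => h x : Finset.univ ⊆ _)
      rw [Finset.card_univ, ← Nat.card_eq_fintype_card, GaloisField.card 2 2 two_ne_zero] at h1
      have h3 := Finset.card_le_two (a := (0 : GaloisField 2 2)) (b := 1)
      omega
    rw [Finset.mem_insert, Finset.mem_singleton, not_or] at hx
    refine ⟨x, mul_left_cancel₀ (sub_ne_zero.2 hx.2) ?_⟩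
    push_cast
    linear_combination pow_three_eq_one hx.1 - (x - 1) * (1 + d) * h2

theorem isIntegral_of_quintic {R A : Type*} [CommRing R] [CommRing A] [Algebra R A] (x : A)
    (p q s : R)
    (hx : x ^ 5 + algebraMap R A p * x ^ 3 + algebraMap R A q * x ^ 2 + algebraMap R A s = 0) :
    IsIntegral R x :=
  ⟨X ^ 5 + C p * X ^ 3 + C q * X ^ 2 + C s, by monicity!, by simpa using hx⟩

theorem two_dvd_subIndex (a b c : ℤ) (j : ℕ) (ha : Odd a) (hac : (4 : ℤ) ∣ c + a)
    (hb : b = 2 ^ (2 * (j + 1)) * c) (hc : c ≠ 0)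
    (hirr : Irreducible (X ^ 5 + C (a : ℚ) * X ^ 2 + C (b : ℚ)))
    {K : Type*} [Field K] [NumberField K] (α : K)
    (hroot : α ^ 5 + (a : K) * α ^ 2 + (b : K) = 0)
    (hgen : Algebra.adjoin ℚ ({α} : Set K) = ⊤) (θ : 𝓞 K) : 2 ∣ subIndex θ := by
  obtain ⟨m, hm⟩ : ∃ m : ℤ, -(a * c) = 1 + 4 * m := by
    obtain ⟨d, rfl⟩ := ha
    obtain ⟨e, he⟩ := hac
    exact ⟨d ^ 2 + d - e * (2 * d + 1), by linear_combination -(2 * d + 1) * he⟩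
  have hα0 : α ≠ 0 := by
    rintro rfl
    simp [hc, hb] at hroot
  have hbK : (b : K) = 2 ^ (2 * (j + 1)) * c := by
    rw [hb]
    push_cast
    rfl
  have hmK : -(a * c : K) = 1 + 4 * m := mod_cast congrArg (Int.cast (R := K)) hm
  obtain ⟨A, rfl⟩ : ∃ A : 𝓞 K, algebraMap (𝓞 K) K A = α := by
    refine IsIntegralClosure.isIntegral_iff.1 (isIntegral_of_quintic α 0 a b ?_)
    rw [map_zero, zero_mul, add_zero, eq_intCast, eq_intCast, hroot]
  have hinj := RingOfIntegers.coe_injective (K := K)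
  set α := algebraMap (𝓞 K) K A
  have hgK : (-(2 ^ (j + 1) * c) / α) ^ 5 = (1 + 4 * m) * (-(2 ^ (j + 1) * c) / α) ^ 3 +
      8 * (2 ^ (3 * j) * c ^ 4) := by
    rw [← hmK]
    field_simp
    rw [hbK] at hroot
    linear_combination (-2 ^ (3 * (j + 1)) : K) * hroot
  obtain ⟨G, hG⟩ : ∃ G : 𝓞 K, algebraMap (𝓞 K) K G = -(2 ^ (j + 1) * c) / α := by
    refine IsIntegralClosure.isIntegral_iff.1
      (isIntegral_of_quintic _ (-(1 + 4 * m)) 0 (-(8 * (2 ^ (3 * j) * c ^ 4))) ?_)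
    rw [map_zero, zero_mul, add_zero, eq_intCast, eq_intCast, hgK]
    push_cast
    ring
  rw [← hG] at hgK
  rw [eq_div_iff hα0] at hG
  have hGA : G * A = -(2 ^ (j + 1) * c) := hinj (by
    rw [map_mul, hG, map_neg, map_mul, map_pow, map_ofNat, map_intCast])
  obtain ⟨D, hD⟩ : ∃ D : 𝓞 K, 2 * D = G * (G - 1) := by
    obtain ⟨D, hD⟩ := IsIntegralClosure.isIntegral_iff (A := 𝓞 K).1 <|
      isIntegral_trans (R := ℤ) _ <| isIntegral_of_quintic
        (algebraMap (𝓞 K) K G * (algebraMap (𝓞 K) K G - 1) / 2)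
        (-((1 + m) * G ^ 2))
        (m * G ^ 3 - 2 ^ (3 * j) * c ^ 4 * G + 3 * (2 ^ (3 * j) * c ^ 4)) 0 (by
          simp only [map_neg, map_add, map_sub, map_mul, map_pow, map_ofNat, map_intCast, map_zero,
            map_one]
          set g := algebraMap (𝓞 K) K G
          linear_combination (g * (g - 1) / 2) ^ 2 * (g - 3) / 8 * hgK)
    refine ⟨D, hinj ?_⟩
    rw [map_mul, hD, map_mul, map_sub, map_ofNat, map_one, mul_div_cancel₀ _ two_ne_zero]
  have h2 : (2 : GaloisField 2 2) = 0 := CharTwo.two_eq_zero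
  have hirr' : Irreducible ((X ^ 5 + C a * X ^ 2 + C b : ℤ[X]).map (algebraMap ℤ ℚ)) := by
    have : (X ^ 5 + C a * X ^ 2 + C b : ℤ[X]).map (algebraMap ℤ ℚ) =
      X ^ 5 + C (a : ℚ) * X ^ 2 + C (b : ℚ) := by simp
    rwa [this]
  have hex (r : WittVector 2 (GaloisField 2 2)) (hr : r ^ 5 + a * r ^ 2 + b = 0) :
      ∃ ψ : 𝓞 K →+* WittVector 2 (GaloisField 2 2), ψ A = r := by
    refine exists_ringHom_of_root _ hirr' A (hinj ?_) hgen
      (FractionRing (WittVector 2 (GaloisField 2 2))) r (by simpa using hr)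
    rw [← aeval_algebraMap_apply, map_zero]
    simpa using hroot
  have hunram (x : GaloisField 2 2) (hx : x ≠ 0) : ∃ φ : 𝓞 K →+* GaloisField 2 2, φ A = x := by
    obtain ⟨r, hr, hrx⟩ := WittVector.exists_root_of_pow_three_eq_one a b ha
      (by rw [hb, pow_mul]; exact ((even_two.pow_of_ne_zero two_ne_zero).pow_of_ne_zero
        j.succ_ne_zero).mul_right c) x
      (GaloisField.pow_three_eq_one hx)
    obtain ⟨ψ, hψ⟩ := hex r hr
    exact ⟨WittVector.constantCoeff.comp ψ, by rw [RingHom.comp_apply, hψ, hrx]⟩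
  have hsplit (y : GaloisField 2 2) (hy : y ^ 2 + y = m) :
      ∃ φ : 𝓞 K →+* GaloisField 2 2, φ A = 0 ∧ φ D = y := by
    obtain ⟨r, w, hr, hrw, hwy, hr0⟩ := WittVector.exists_root_of_two_dvd a b c m j hb hm y hy
    obtain ⟨ψ, hψ⟩ := hex r hr
    have hψG : ψ G = 1 + 2 * w := by
      have h := congrArg ψ hGA
      rw [map_mul, hψ, map_neg, map_mul, map_pow, map_ofNat, map_intCast, ← hrw] at h
      refine mul_right_cancel₀ (fun h0 => ?_) h
      rw [h0, mul_zero, eq_comm, neg_eq_zero] at hrw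
      exact mul_ne_zero (pow_ne_zero _ two_ne_zero) (Int.cast_ne_zero.2 hc) hrw
    have hψD : ψ D = (1 + 2 * w) * w := by
      refine mul_left_cancel₀ (two_ne_zero' (WittVector 2 (GaloisField 2 2))) ?_
      have h := congrArg ψ hD
      rw [map_mul, map_mul, map_sub, hψG, map_ofNat, map_one] at h
      rw [h]
      ring
    refine ⟨WittVector.constantCoeff.comp ψ, ?_, ?_⟩
    · rw [RingHom.comp_apply, hψ, hr0]
    · rw [RingHom.comp_apply, hψD, map_mul, map_add, map_mul, map_ofNat, h2, hwy]
      simp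
  obtain ⟨y, hy⟩ := GaloisField.exists_sq_add_eq_intCast m
  obtain ⟨φ', hφ'A, hφ'D⟩ := hsplit (y + 1) (by linear_combination hy + (y + 1) * h2)
  have hall (x : GaloisField 2 2) :
      ∃ φ : 𝓞 K →+* GaloisField 2 2, φ A = x ∧ (x = 0 → φ D = y) := by
    by_cases hx : x = 0
    · obtain ⟨φ, hφ, hφD⟩ := hsplit y hy
      exact ⟨φ, hφ.trans hx.symm, fun _ => hφD⟩
    · obtain ⟨φ, hφ⟩ := hunram x hx
      exact ⟨φ, hφ, fun h => absurd h hx⟩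
  choose φ hφ hφD using hall
  have hne (x : GaloisField 2 2) : φ' ≠ φ x := by
    intro h
    have hx : x = 0 := by rw [← hφ x, ← h, hφ'A]
    have hD' := hφD x hx
    rw [← h, hφ'D] at hD'
    simp at hD'
  refine dvd_subIndex_of_injective 2 (fun i : Option (GaloisField 2 2) => i.elim φ' φ) ?_ ?_ θ
  · rintro (_ | x) (_ | x') h
    · rfl
    · exact absurd h (hne x')
    · exact absurd h.symm (hne x)
    · have h' : φ x A = φ x' A := congrArg (fun φ : 𝓞 K →+* GaloisField 2 2 => φ A) h
      rw [hφ, hφ] at h'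
      rw [h']
  · rw [Finite.card_option]
    exact Nat.lt_succ_self _

theorem stmt_10 (a b : ℤ) (k : ℕ) (hk : 0 < k)
    (hirr : Irreducible (X ^ 5 + C (a : ℚ) * X ^ 2 + C (b : ℚ)))
    (ha : Odd a) (hb : padicValInt 2 b = 2 * k)
    (hcong : (4 : ℤ) ∣ (b / 2 ^ (2 * k) + a))
    (K : Type*) [Field K] [NumberField K] (α : K)
    (hroot : α ^ 5 + (a : K) * α ^ 2 + (b : K) = 0)
    (hgen : Algebra.adjoin ℚ ({α} : Set K) = ⊤) :
    IsCommonIndexDivisor 2 K ∧ ¬ IsMonogenic K := by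
  have hb0 : b ≠ 0 := by
    rintro rfl
    simp at hb
    omega
  obtain ⟨c, hc⟩ : (2 : ℤ) ^ (2 * k) ∣ b := by
    rw [← hb]
    exact mod_cast padicValInt_dvd (p := 2) b
  rw [hc, Int.mul_ediv_cancel_left _ (by positivity)] at hcong
  obtain ⟨j, rfl⟩ := Nat.exists_eq_succ_of_ne_zero hk.ne'
  have hc0 : c ≠ 0 := by
    rintro rfl
    exact hb0 (by rw [hc, mul_zero])
  have h := two_dvd_subIndex a b c j ha hcong hc hc0 hirr α hroot hgen
  refine ⟨fun θ _ => h θ, ?_⟩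
  rintro ⟨θ, hθ⟩
  have h1 : subIndex θ = 1 := by
    rw [subIndex, hθ]
    exact AddSubgroup.index_top
  exact absurd (h1 ▸ h θ) (by norm_num)
end

section
/- If 2 is a common index divisor of the number field K defined by an irreducible trinomial x^5 + a x^2 + b, then 2 divides b. -/
open Polynomial NumberField

theorem finite_of_torsion_of_finite {M : Type*} [AddCommGroup M] [Module.Finite ℤ M]
    (h : ∀ x : M, ∃ n : ℤ, n ≠ 0 ∧ n • x = 0) : Finite M := by
  refine Module.finite_of_fg_torsion M fun {x} => ?_
  obtain ⟨n, hn, hx⟩ := h x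
  exact ⟨⟨n, mem_nonZeroDivisors_of_ne_zero hn⟩, hx⟩

/-- In a field generated over `ℚ` by `α`, every element has a nonzero integer multiple
in `ℤ[α]`. -/
theorem exists_int_mul_mem_adjoin {K : Type*} [Field K] [CharZero K] {α : K}
    (hgen : Algebra.adjoin ℚ ({α} : Set K) = ⊤) (y : K) :
    ∃ n : ℤ, n ≠ 0 ∧ (n : K) * y ∈ Algebra.adjoin ℤ ({α} : Set K) := by
  have hy : y ∈ Algebra.adjoin ℚ ({α} : Set K) := hgen ▸ Algebra.mem_top
  induction hy using Algebra.adjoin_induction with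
  | mem x hx => exact ⟨1, one_ne_zero, by simpa using Algebra.subset_adjoin hx⟩
  | algebraMap r =>
    refine ⟨r.den, by exact_mod_cast r.den_nz, ?_⟩
    have h : ((r.den : ℤ) : K) * algebraMap ℚ K r = (r.num : K) := by
      rw [eq_ratCast]
      exact_mod_cast congrArg (Rat.cast : ℚ → K) (Rat.den_mul_eq_num r)
    rw [h]
    exact intCast_mem _ _
  | add x y _ _ hx hy =>
    obtain ⟨m, hm, hx⟩ := hx
    obtain ⟨n, hn, hy⟩ := hy
    refine ⟨m * n, mul_ne_zero hm hn, ?_⟩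
    have h : ((m * n : ℤ) : K) * (x + y) = n * (m * x) + m * (n * y) := by push_cast; ring
    rw [h]
    exact add_mem (mul_mem (intCast_mem _ _) hx) (mul_mem (intCast_mem _ _) hy)
  | mul x y _ _ hx hy =>
    obtain ⟨m, hm, hx⟩ := hx
    obtain ⟨n, hn, hy⟩ := hy
    refine ⟨m * n, mul_ne_zero hm hn, ?_⟩
    have h : ((m * n : ℤ) : K) * (x * y) = (m * x) * (n * y) := by push_cast; ring
    rw [h]
    exact mul_mem hx hy

theorem exists_int_smul_mem_adjoin {K : Type*} [Field K] [NumberField K] {θ : 𝓞 K}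
    (hgen : Algebra.adjoin ℚ ({(θ : K)} : Set K) = ⊤) (y : 𝓞 K) :
    ∃ n : ℤ, n ≠ 0 ∧ n • y ∈ Algebra.adjoin ℤ ({θ} : Set (𝓞 K)) := by
  obtain ⟨n, hn, h⟩ := exists_int_mul_mem_adjoin hgen (y : K)
  refine ⟨n, hn, ?_⟩
  let f : 𝓞 K →ₐ[ℤ] K := (algebraMap (𝓞 K) K).toIntAlgHom
  have hf : Algebra.adjoin ℤ ({(θ : K)} : Set K) = (Algebra.adjoin ℤ {θ}).map f := by
    rw [AlgHom.map_adjoin, Set.image_singleton]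
    rfl
  rw [hf] at h
  obtain ⟨z, hz, hzy⟩ := h
  have : z = n • y := by
    apply RingOfIntegers.coe_injective
    have hzy' : (z : K) = n * y := hzy
    exact hzy'.trans (by simp)
  exact this ▸ hz

theorem finite_quotient_adjoin {K : Type*} [Field K] [NumberField K] {θ : 𝓞 K}
    (hgen : Algebra.adjoin ℚ ({(θ : K)} : Set K) = ⊤) :
    Finite (𝓞 K ⧸ (Algebra.adjoin ℤ ({θ} : Set (𝓞 K))).toSubring.toAddSubgroup) := by
  set H := (Algebra.adjoin ℤ ({θ} : Set (𝓞 K))).toSubring.toAddSubgroup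
  have : Module.Finite ℤ (𝓞 K ⧸ H) :=
    Module.Finite.of_surjective (QuotientAddGroup.mk' H).toIntLinearMap
      (QuotientAddGroup.mk'_surjective H)
  refine finite_of_torsion_of_finite fun x => ?_
  obtain ⟨y, rfl⟩ := QuotientAddGroup.mk'_surjective H x
  obtain ⟨n, hn, h⟩ := exists_int_smul_mem_adjoin hgen y
  refine ⟨n, hn, ?_⟩
  rw [← map_zsmul]
  exact (QuotientAddGroup.eq_zero_iff _).2 h

/-- If a prime `p` divides the index of `ℤ[θ]`, then some algebraic integer outside `ℤ[θ]` has its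
`p`-multiple in `ℤ[θ]`. -/
theorem exists_notMem_adjoin_of_dvd_subIndex {K : Type*} [Field K] [NumberField K] {θ : 𝓞 K}
    (hgen : Algebra.adjoin ℚ ({(θ : K)} : Set K) = ⊤) {p : ℕ} (hp : p.Prime)
    (h : p ∣ subIndex θ) :
    ∃ x : 𝓞 K, x ∉ Algebra.adjoin ℤ ({θ} : Set (𝓞 K)) ∧
      (p : 𝓞 K) * x ∈ Algebra.adjoin ℤ ({θ} : Set (𝓞 K)) := by
  have := finite_quotient_adjoin hgen
  have : Fact p.Prime := ⟨hp⟩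
  set H := (Algebra.adjoin ℤ ({θ} : Set (𝓞 K))).toSubring.toAddSubgroup
  have hc : p ∣ Nat.card (𝓞 K ⧸ H) := h
  obtain ⟨q, hq⟩ := exists_prime_addOrderOf_dvd_card' p hc
  obtain ⟨x, rfl⟩ := QuotientAddGroup.mk'_surjective H q
  refine ⟨x, fun hx => ?_, ?_⟩
  · have h0 : QuotientAddGroup.mk' H x = 0 := (QuotientAddGroup.eq_zero_iff _).2 hx
    rw [h0, addOrderOf_zero] at hq
    exact hp.one_lt.ne hq
  · have h0 := addOrderOf_nsmul_eq_zero (QuotientAddGroup.mk' H x)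
    rw [hq, ← map_nsmul] at h0
    have h1 : p • x ∈ H := (QuotientAddGroup.eq_zero_iff _).1 h0
    rw [nsmul_eq_mul] at h1
    exact h1

/-- If `x` is integral over `ℤ` and `p x ∈ A`, then some power of `p x` lies in `p A`. -/
theorem exists_pow_eq_mul_of_isIntegral {R : Type*} [CommRing R] (A : Subalgebra ℤ R) {p : ℤ}
    {x : R} (hx : IsIntegral ℤ x) (hpx : (p : R) * x ∈ A) :
    ∃ n : ℕ, ∃ z ∈ A, ((p : R) * x) ^ n = p * z := by
  obtain ⟨f, hf, hfx⟩ := hx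
  refine ⟨f.natDegree, -∑ i ∈ Finset.range f.natDegree,
    (f.coeff i : R) * ((p : R) ^ (f.natDegree - 1 - i) * ((p : R) * x) ^ i), ?_, ?_⟩
  · exact neg_mem (sum_mem fun i _ => mul_mem (intCast_mem _ _)
      (mul_mem (pow_mem (intCast_mem _ _) _) (pow_mem hpx _)))
  · rw [eval₂_eq_sum_range, Finset.sum_range_succ, hf.coeff_natDegree] at hfx
    simp only [map_one, one_mul, eq_intCast] at hfx
    rw [mul_pow, eq_neg_of_add_eq_zero_right hfx, mul_neg, mul_neg, Finset.mul_sum,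
      Finset.mul_sum]
    congr 1
    refine Finset.sum_congr rfl fun i hi => ?_
    have hi' : f.natDegree = (f.natDegree - 1 - i) + i + 1 := by
      have := Finset.mem_range.1 hi
      omega
    rw [mul_pow]
    conv_lhs => rw [hi']
    ring

theorem isReduced_of_forall_isSquare {B : Type*} [CommRing B] [Finite B]
    (h : ∀ z : B, ∃ w, w ^ 2 = z) : IsReduced B := by
  have hinj : Function.Injective fun w : B => w ^ 2 := Finite.injective_iff_surjective.2 h
  refine (isReduced_iff_pow_one_lt 2 one_lt_two).2 fun x hx => hinj ?_
  simpa using hx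

/-- For `b` odd, every element of a ring of characteristic two generated by a root of
`X ^ 5 + a X ^ 2 + b` is a square. -/
theorem exists_sq_eq_of_trinomial {B : Type*} [CommRing B] (h2 : (2 : B) = 0) {t : B} {a b : ℤ}
    (hb : Odd b) (ht : t ^ 5 + a * t ^ 2 + b = 0) (hgen : Algebra.adjoin ℤ ({t} : Set B) = ⊤)
    (z : B) : ∃ w, w ^ 2 = z := by
  have hint (n : ℤ) : (n : B) ^ 2 = n := by
    obtain ⟨k, hk⟩ := Int.even_mul_pred_self n
    have : (n : B) * (n - 1) = k + k := by exact_mod_cast congrArg (Int.cast : ℤ → B) hk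
    linear_combination this + k * h2
  have hb1 : (b : B) = 1 := by
    obtain ⟨k, rfl⟩ := hb
    push_cast
    linear_combination (k : B) * h2
  rw [hb1] at ht
  have hz : z ∈ Algebra.adjoin ℤ ({t} : Set B) := hgen ▸ Algebra.mem_top
  induction hz using Algebra.adjoin_induction with
  | mem x hx =>
    obtain rfl : x = t := hx
    -- `s` is the inverse of `x`
    let s := x ^ 4 + a * x
    have hs : x * s = 1 := by
      simp only [s]
      linear_combination ht - h2
    refine ⟨s ^ 2 * (a * x + 1), ?_⟩
    have hx : (a * x + 1) ^ 2 = x ^ 5 := by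
      linear_combination x ^ 2 * hint a - ht + (a * x + a * x ^ 2 + 1) * h2
    calc (s ^ 2 * (a * x + 1)) ^ 2 = s ^ 4 * (a * x + 1) ^ 2 := by ring
      _ = (x * s) ^ 4 * x := by rw [hx]; ring
      _ = x := by rw [hs]; ring
  | algebraMap r => exact ⟨r, by simpa using hint r⟩
  | add x y _ _ hx hy =>
    obtain ⟨v, rfl⟩ := hx
    obtain ⟨w, rfl⟩ := hy
    exact ⟨v + w, by linear_combination v * w * h2⟩
  | mul x y _ _ hx hy =>
    obtain ⟨v, rfl⟩ := hx
    obtain ⟨w, rfl⟩ := hy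
    exact ⟨v * w, by ring⟩

theorem isReduced_adjoin_quotient_two {R : Type*} [CommRing R] [Module.Finite ℤ R] {θ : R}
    {a b : ℤ} (hb : Odd b) (hθ : θ ^ 5 + a * θ ^ 2 + b = 0) :
    IsReduced (Algebra.adjoin ℤ ({θ} : Set R) ⧸
      Ideal.span {(2 : Algebra.adjoin ℤ ({θ} : Set R))}) := by
  set A := Algebra.adjoin ℤ ({θ} : Set R)
  set I := Ideal.span {(2 : A)}
  have : Module.Finite ℤ A :=
    inferInstanceAs (Module.Finite ℤ (Subalgebra.toSubmodule A))
  have h2 : (2 : A ⧸ I) = 0 :=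
    Ideal.Quotient.eq_zero_iff_mem.2 (Ideal.mem_span_singleton_self 2)
  have : Module.Finite ℤ (A ⧸ I) :=
    Module.Finite.of_surjective (Ideal.Quotient.mkₐ ℤ I).toLinearMap
      (Ideal.Quotient.mkₐ_surjective ℤ I)
  have : Finite (A ⧸ I) := finite_of_torsion_of_finite fun x =>
    ⟨2, two_ne_zero, by rw [zsmul_eq_mul]; push_cast; rw [h2, zero_mul]⟩
  let t : A := ⟨θ, Algebra.self_mem_adjoin_singleton ℤ θ⟩
  have ht : t ^ 5 + a * t ^ 2 + b = 0 := Subtype.ext (by simpa [t] using hθ)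
  have htgen : Algebra.adjoin ℤ ({t} : Set A) = ⊤ := by
    apply Subalgebra.map_injective (f := A.val) Subtype.val_injective
    rw [AlgHom.map_adjoin, Set.image_singleton, Algebra.map_top, Subalgebra.range_val]
    rfl
  have hq : Algebra.adjoin ℤ ({Ideal.Quotient.mk I t} : Set (A ⧸ I)) = ⊤ := by
    have h := congrArg (Subalgebra.map (Ideal.Quotient.mkₐ ℤ I)) htgen
    rw [AlgHom.map_adjoin, Set.image_singleton, Algebra.map_top,
      (AlgHom.range_eq_top _).2 (Ideal.Quotient.mkₐ_surjective ℤ I)] at h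
    exact h
  refine isReduced_of_forall_isSquare (exists_sq_eq_of_trinomial h2 (a := a) hb ?_ hq)
  simpa using congrArg (Ideal.Quotient.mk I) ht

theorem stmt_13 (a b : ℤ)
    (hirr : Irreducible (X ^ 5 + C (a : ℚ) * X ^ 2 + C (b : ℚ)))
    (K : Type*) [Field K] [NumberField K] (α : K)
    (hroot : α ^ 5 + (a : K) * α ^ 2 + (b : K) = 0)
    (hgen : Algebra.adjoin ℚ ({α} : Set K) = ⊤)
    (hcid : IsCommonIndexDivisor 2 K) :
    (2 : ℤ) ∣ b := by
  by_contra hb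
  have hodd : Odd b := by
    rwa [← Int.not_even_iff_odd, even_iff_two_dvd]
  have hα : IsIntegral ℤ α := by
    refine ⟨X ^ 5 + C a * X ^ 2 + C b, by monicity!, ?_⟩
    simpa only [eval₂_add, eval₂_mul, eval₂_C, eval₂_X_pow, algebraMap_int_eq,
      Int.coe_castRingHom] using hroot
  obtain ⟨θ, rfl⟩ : ∃ θ : 𝓞 K, (θ : K) = α := ⟨⟨α, hα⟩, rfl⟩
  have hθ : θ ^ 5 + a * θ ^ 2 + b = 0 := by
    apply RingOfIntegers.coe_injective
    simpa using hroot
  obtain ⟨x, hx, h2x⟩ := exists_notMem_adjoin_of_dvd_subIndex hgen Nat.prime_two (hcid θ hgen)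
  set A := Algebra.adjoin ℤ ({θ} : Set (𝓞 K))
  have hred : IsReduced (A ⧸ Ideal.span {(2 : A)}) := isReduced_adjoin_quotient_two hodd hθ
  obtain ⟨n, z, hz, hn⟩ := exists_pow_eq_mul_of_isIntegral A (p := 2)
    (RingOfIntegers.isIntegral x) (by exact_mod_cast h2x)
  let y : A := ⟨(2 : ℕ) * x, h2x⟩
  have hcoe : ((2 : A) : 𝓞 K) = 2 := rfl
  have hy : y ^ n = 2 * ⟨z, hz⟩ := Subtype.ext (by simpa [y, hcoe] using hn)
  have hmem : y ∈ Ideal.span {(2 : A)} := by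
    rw [← Ideal.Quotient.eq_zero_iff_mem]
    refine eq_zero_of_pow_eq_zero (n := n) ?_
    rw [← map_pow, Ideal.Quotient.eq_zero_iff_mem, hy]
    exact Ideal.mul_mem_right _ _ (Ideal.mem_span_singleton_self 2)
  obtain ⟨w, hw⟩ := Ideal.mem_span_singleton.1 hmem
  have hxw : (2 : 𝓞 K) * x = 2 * w := congrArg Subtype.val hw
  exact hx (mul_left_cancel₀ two_ne_zero hxw ▸ w.2)
end

section
/- If 3 is a common index divisor of the number field K defined by an irreducible trinomial x^5 + a x^2 + b, then 3 divides b. -/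
open Polynomial NumberField

theorem AddSubgroup.not_dvd_index_of_forall_zsmul_mem {A : Type*} [AddCommGroup A]
    [Module.Finite ℤ A] (H : AddSubgroup A) {p : ℕ} (hp : p.Prime) {m : ℤ}
    (hm : ¬ (p : ℤ) ∣ m) (h : ∀ x : A, m • x ∈ H) : ¬ p ∣ H.index := by
  have hm0 : m ≠ 0 := by rintro rfl; exact hm (dvd_zero _)
  have hkill (x : A ⧸ H) : m • x = 0 := by
    induction x using QuotientAddGroup.induction_on with
    | H x => exact (QuotientAddGroup.eq_zero_iff (m • x)).mpr (h x)
  have : Module.Finite ℤ (A ⧸ H) :=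
    inferInstanceAs (Module.Finite ℤ (A ⧸ AddSubgroup.toIntSubmodule H))
  have : Finite (A ⧸ H) := Module.finite_of_fg_torsion _ fun x =>
    ⟨⟨m, mem_nonZeroDivisors_of_ne_zero hm0⟩, hkill x⟩
  have : Fact p.Prime := ⟨hp⟩
  intro hdvd
  obtain ⟨x, hx⟩ := exists_prime_addOrderOf_dvd_card' (G := A ⧸ H) p hdvd
  exact hm (hx ▸ addOrderOf_dvd_iff_zsmul_eq_zero.mpr (hkill x))

theorem not_dvd_subIndex_of_derivative_dvd {K : Type*} [Field K] [NumberField K] (θ : 𝓞 K)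
    (hθ : Algebra.adjoin ℚ ({(θ : K)} : Set K) = ⊤) {f : ℤ[X]}
    (hf : minpoly ℚ (θ : K) = f.map (Int.castRingHom ℚ)) {p : ℕ} (hp : p.Prime) {E : ℤ}
    (hE : ¬ (p : ℤ) ∣ E) (hdvd : aeval θ (derivative f) ∣ (E : 𝓞 K)) :
    ¬ p ∣ subIndex θ := by
  have hint : IsIntegral ℚ (θ : K) := Algebra.IsIntegral.isIntegral _
  let B := PowerBasis.ofAdjoinEqTop hint hθ
  have hgen : B.gen = θ := by simp [B]
  set N : ℤ := Algebra.norm ℤ (aeval θ (derivative f)) with hN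
  have hpN : ¬ (p : ℤ) ∣ N := fun h => by
    have hNE := h.trans (map_dvd (Algebra.norm ℤ) hdvd)
    rw [← eq_intCast (algebraMap ℤ (𝓞 K)), Algebra.norm_algebraMap] at hNE
    exact hE ((Nat.prime_iff_prime_int.mp hp).dvd_of_dvd_pow hNE)
  have hder : aeval B.gen (derivative (minpoly ℚ B.gen)) =
      ((aeval θ (derivative f) : 𝓞 K) : K) := by
    rw [hgen, hf, derivative_map, ← algebraMap_int_eq, aeval_map_algebraMap]
    exact aeval_algebraMap_apply K θ (derivative f)
  have hdiscr : Algebra.discr ℚ B.basis =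
      (-1) ^ (Module.finrank ℚ K * (Module.finrank ℚ K - 1) / 2) * (N : ℚ) := by
    rw [Algebra.discr_powerBasis_eq_norm, hder, hN, Algebra.coe_norm_int]
  refine AddSubgroup.not_dvd_index_of_forall_zsmul_mem _ hp hpN fun x => ?_
  have hmem := Algebra.discr_mul_isIntegral_mem_adjoin ℚ (R := ℤ) (B := B)
    (hgen ▸ θ.isIntegral_coe) x.isIntegral_coe
  rw [hgen, hdiscr] at hmem
  have hmemN : ((N • x : 𝓞 K) : K) ∈ Algebra.adjoin ℤ ({(θ : K)} : Set K) := by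
    rcases neg_one_pow_eq_or ℚ (Module.finrank ℚ K * (Module.finrank ℚ K - 1) / 2) with h | h
    · simpa [h, Algebra.smul_def] using hmem
    · simpa [h, Algebra.smul_def] using neg_mem hmem
  have himage : Algebra.adjoin ℤ ({(θ : K)} : Set K) =
      (Algebra.adjoin ℤ ({θ} : Set (𝓞 K))).map (IsScalarTower.toAlgHom ℤ (𝓞 K) K) := by
    rw [AlgHom.map_adjoin, Set.image_singleton]
    rfl
  rw [himage] at hmemN
  obtain ⟨y, hy, hyx⟩ := hmemN
  rwa [RingOfIntegers.coe_injective hyx] at hy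

theorem minpoly_eq_of_irreducible_trinomial {K : Type*} [Field K] [NumberField K] {a b : ℤ}
    (hirr : Irreducible (X ^ 5 + C (a : ℚ) * X ^ 2 + C (b : ℚ))) {α : K}
    (hroot : α ^ 5 + (a : K) * α ^ 2 + (b : K) = 0) :
    minpoly ℚ α = (X ^ 5 + C a * X ^ 2 + C b : ℤ[X]).map (Int.castRingHom ℚ) := by
  have hmonic : (X ^ 5 + C (a : ℚ) * X ^ 2 + C (b : ℚ)).Monic := by monicity!
  rw [← minpoly.eq_of_irreducible_of_monic hirr (by simpa using hroot) hmonic]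
  simp

theorem derivative_dvd_of_trinomial_eq_zero {R : Type*} [CommRing R] {a b θ : R}
    (h : θ ^ 5 + a * θ ^ 2 + b = 0) :
    5 * θ ^ 4 + 2 * a * θ ∣ b ^ 2 * (5 ^ 5 * b ^ 3 + 2 ^ 2 * 3 ^ 3 * a ^ 5) := by
  set c := (3 * a * θ ^ 2) ^ 4 - (3 * a * θ ^ 2) ^ 3 * (5 * b) +
    (3 * a * θ ^ 2) ^ 2 * (5 * b) ^ 2 - 3 * a * θ ^ 2 * (5 * b) ^ 3 + (5 * b) ^ 4 -
    27 * a ^ 5 * (3 * a * θ ^ 2 - 5 * b) - 162 * a ^ 5 * b with hc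
  refine ⟨-(θ * c), ?_⟩
  rw [hc]
  linear_combination (5 * c - 243 * a ^ 5 * (θ ^ 5 - a * θ ^ 2 - b)) * h

theorem stmt_14 (a b : ℤ)
    (hirr : Irreducible (X ^ 5 + C (a : ℚ) * X ^ 2 + C (b : ℚ)))
    (K : Type*) [Field K] [NumberField K] (α : K)
    (hroot : α ^ 5 + (a : K) * α ^ 2 + (b : K) = 0)
    (hgen : Algebra.adjoin ℚ ({α} : Set K) = ⊤)
    (hcid : IsCommonIndexDivisor 3 K) :
    (3 : ℤ) ∣ b := by
  by_contra hb
  have hα : IsIntegral ℤ α := ⟨X ^ 5 + C a * X ^ 2 + C b, by monicity!, by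
    simp only [eval₂_add, eval₂_mul, eval₂_pow, eval₂_X, eval₂_C]
    simpa using hroot⟩
  let θ : 𝓞 K := ⟨α, hα⟩
  have hθ : θ ^ 5 + (a : 𝓞 K) * θ ^ 2 + (b : 𝓞 K) = 0 :=
    RingOfIntegers.coe_injective (by
      simp only [map_add, map_mul, map_pow, map_intCast, map_zero]
      exact hroot)
  have hE : ¬ ((3 : ℕ) : ℤ) ∣ b ^ 2 * (5 ^ 5 * b ^ 3 + 2 ^ 2 * 3 ^ 3 * a ^ 5) := by
    rintro ⟨c, hc⟩
    have h5 : (3 : ℤ) ∣ 5 ^ 5 * b ^ 5 :=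
      ⟨c - 36 * a ^ 5 * b ^ 2, by push_cast at hc; linear_combination hc⟩
    rcases Int.prime_three.dvd_or_dvd h5 with h5 | h5
    · norm_num at h5
    · exact hb (Int.prime_three.dvd_of_dvd_pow h5)
  refine not_dvd_subIndex_of_derivative_dvd θ hgen
    (minpoly_eq_of_irreducible_trinomial hirr hroot) Nat.prime_three hE ?_ (hcid θ hgen)
  convert derivative_dvd_of_trinomial_eq_zero hθ using 1
  · simp [map_ofNat]
    ring
  · push_cast
    ring
end

section
/- Let K be the number field defined by an irreducible trinomial x^5 + a x^2 + b with ν_3(b) = 2k for some positive integer k, a ≡ ±1 (mod 9), and (b/3^{ν_3(b)})·a ≡ −1 (mod 3). Then 3 is a common index divisor of K and K is not monogenic. -/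
open Polynomial NumberField

theorem natCast_mem_sq_of_sq_eq {R : Type*} [CommRing R] {p : ℕ} {P : Ideal R} [P.IsMaximal] {ν δ : R}
    (hp : (p : R) ∈ P) (hν : ν ^ 2 = p * δ) (hδ : δ ∉ P) : (p : R) ∈ P ^ 2 := by
  have hνP : ν ∈ P := Ideal.IsPrime.mem_of_pow_mem inferInstance 2 (hν ▸ P.mul_mem_right δ hp)
  obtain ⟨u, i, hi, hu⟩ := Ideal.IsMaximal.exists_inv (I := P) inferInstance hδ
  have h1 : (p : R) = ν ^ 2 * u + p * i := by
    linear_combination -u * hν - p * hu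
  rw [h1]
  refine add_mem (Ideal.mul_mem_right _ _ (Ideal.pow_mem_pow hνP 2)) ?_
  rw [pow_two]
  exact Ideal.mul_mem_mul hp hi

section General

variable {K : Type*} [Field K] [NumberField K]

/-- If the trace of `z` is not divisible by the prime `p`, then `z` is not nilpotent modulo `p`. -/
theorem exists_isMaximal_of_not_dvd_trace {p : ℕ} [Fact p.Prime] {z : 𝓞 K} {t : ℤ}
    (ht : Algebra.trace ℚ K (z : K) = t) (hp : ¬ (p : ℤ) ∣ t) :
    ∃ P : Ideal (𝓞 K), P.IsMaximal ∧ (p : 𝓞 K) ∈ P ∧ z ∉ P := by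
  by_contra! h
  apply hp
  have hz : z ∈ (Ideal.span {(p : 𝓞 K)}).radical := by
    rw [Ideal.radical_eq_sInf, Submodule.mem_sInf]
    rintro P ⟨hle, hP⟩
    have hpP := hle (Ideal.mem_span_singleton_self _)
    refine h P (hP.isMaximal ?_) hpP
    rintro rfl
    exact (Fact.out : p.Prime).ne_zero (Nat.cast_eq_zero.mp ((Submodule.mem_bot _).mp hpP))
  obtain ⟨n, hn⟩ := hz
  obtain ⟨w, hw⟩ := Ideal.mem_span_singleton'.mp hn
  have htr : Algebra.trace ℤ (𝓞 K) z = t := by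
    have := Algebra.coe_trace_int (K := K) z
    rw [ht] at this
    exact_mod_cast this
  let B := NumberField.RingOfIntegers.basis K
  let f := (Int.castRingHom (ZMod p)).mapMatrix.comp (Algebra.leftMulMatrix B).toRingHom
  have hnil : IsNilpotent (f z) := by
    refine ⟨n, ?_⟩
    rw [← map_pow, ← hw, map_mul, map_natCast]
    have : ((p : ℕ) : Matrix (Module.Free.ChooseBasisIndex ℤ (𝓞 K))
        (Module.Free.ChooseBasisIndex ℤ (𝓞 K)) (ZMod p)) = 0 := CharP.cast_eq_zero _ _
    rw [this, mul_zero]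
  have h0 := (Matrix.isNilpotent_trace_of_isNilpotent hnil).eq_zero
  rw [← ZMod.intCast_zmod_eq_zero_iff_dvd, ← htr, Algebra.trace_eq_matrix_trace B, ← h0]
  simp [f, Matrix.trace]

theorem eq_of_not_dvd_subIndex {p : ℕ} [Fact p.Prime] {θ : 𝓞 K} (hp : ¬ p ∣ subIndex θ)
    {φ ψ : 𝓞 K →+* ZMod p} (h : φ θ = ψ θ) : φ = ψ := by
  have hadj : ∀ x ∈ Algebra.adjoin ℤ ({θ} : Set (𝓞 K)), φ x = ψ x := fun x hx ↦
    AlgHom.adjoin_le_equalizer φ.toIntAlgHom ψ.toIntAlgHom (by simpa [Set.EqOn] using h) hx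
  ext x
  have hx := hadj (subIndex θ • x) ((Algebra.adjoin ℤ ({θ} : Set (𝓞 K))).toSubring.toAddSubgroup.nsmul_index_mem x)
  rw [map_nsmul, map_nsmul, nsmul_eq_mul, nsmul_eq_mul] at hx
  refine mul_left_cancel₀ ?_ hx
  rwa [Ne, ZMod.natCast_eq_zero_iff]

/-- A family of more than `p` distinct homomorphisms to `ZMod p` forces `p` to divide every
index. -/
theorem dvd_subIndex_of_injective_s15 {p : ℕ} [Fact p.Prime] {ι : Type*} [Fintype ι]
    (hι : p < Fintype.card ι) {φ : ι → 𝓞 K →+* ZMod p} (hφ : Function.Injective φ) (θ : 𝓞 K) :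
    p ∣ subIndex θ := by
  by_contra hp
  obtain ⟨i, j, hij, h⟩ := Fintype.exists_ne_map_eq_of_card_lt (fun i ↦ φ i θ)
    (by rwa [ZMod.card])
  exact hij (hφ (eq_of_not_dvd_subIndex hp h))

theorem exists_ringHom_ker_eq {p : ℕ} (hp : p.Prime) {P : Ideal (𝓞 K)}
    (hP : P.absNorm = p) : ∃ φ : 𝓞 K →+* ZMod p, RingHom.ker φ = P := by
  have hcard : Nat.card (𝓞 K ⧸ P) = p := by
    rw [← hP, Ideal.absNorm_apply, Submodule.cardQuot_apply]
  have : Finite (𝓞 K ⧸ P) := Nat.finite_of_card_ne_zero (hcard ▸ hp.ne_zero)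
  have := Fintype.ofFinite (𝓞 K ⧸ P)
  let e := ZMod.ringEquivOfPrime (𝓞 K ⧸ P) hp (by rw [← Nat.card_eq_fintype_card, hcard])
  refine ⟨(e.symm : _ →+* ZMod p).comp (Ideal.Quotient.mk P), ?_⟩
  ext x
  simp [RingHom.mem_ker, Ideal.Quotient.eq_zero_iff_mem]

theorem not_isMonogenic_of_isCommonIndexDivisor {p : ℕ} (hp : p.Prime)
    (h : ∀ θ : 𝓞 K, p ∣ subIndex θ) : ¬ IsMonogenic K := by
  rintro ⟨θ, hθ⟩
  have := h θ
  have h1 : subIndex θ = 1 := by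
    rw [subIndex, hθ]
    simp
  exact hp.one_lt.ne' (Nat.dvd_one.mp (h1 ▸ this))

theorem absNorm_eq_of_ramified {p : ℕ} (hp : p.Prime) (hK : Module.finrank ℚ K = 5)
    {P : Fin 4 → Ideal (𝓞 K)} [∀ i, (P i).IsMaximal] (hinj : Function.Injective P)
    (hmem : ∀ i, (p : 𝓞 K) ∈ P i) (hram : (p : 𝓞 K) ∈ P 3 ^ 2) (i : Fin 4) :
    (P i).absNorm = p := by
  have hcop : ∀ {i j}, i ≠ j → IsCoprime (P i) (P j) := fun h ↦
    Ideal.isCoprime_of_isMaximal (hinj.ne h)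
  have hdvd : P 0 * P 1 * P 2 * P 3 ^ 2 ∣ Ideal.span {(p : 𝓞 K)} := by
    have h : ∀ {I : Ideal (𝓞 K)}, (p : 𝓞 K) ∈ I → I ∣ Ideal.span {(p : 𝓞 K)} := fun hI ↦
      Ideal.dvd_iff_le.mpr ((Ideal.span_singleton_le_iff_mem _).mpr hI)
    refine IsCoprime.mul_dvd ?_ (IsCoprime.mul_dvd ?_ (IsCoprime.mul_dvd ?_ ?_ ?_) ?_) (h hram)
    · exact .pow_right (.mul_left (.mul_left (hcop (by decide)) (hcop (by decide)))
        (hcop (by decide)))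
    · exact .mul_left (hcop (by decide)) (hcop (by decide))
    · exact hcop (by decide)
    all_goals exact h (hmem _)
  have hN := map_dvd Ideal.absNorm hdvd
  have h5 : Ideal.absNorm (Ideal.span {(p : 𝓞 K)}) = p ^ 5 := by
    rw [Ideal.absNorm_span_natCast, NumberField.RingOfIntegers.rank, hK]
  rw [h5, map_mul, map_mul, map_mul, map_pow] at hN
  have hpow : ∀ i, ∃ f, 0 < f ∧ (P i).absNorm = p ^ f := by
    intro i
    have hd : (P i).absNorm ∣ p ^ 5 := by
      rw [← h5]
      exact Ideal.absNorm_dvd_absNorm_of_le ((Ideal.span_singleton_le_iff_mem _).mpr (hmem i))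
    obtain ⟨f, -, hf⟩ := (Nat.dvd_prime_pow hp).mp hd
    refine ⟨f, Nat.pos_of_ne_zero fun h ↦ ?_, hf⟩
    rw [h, pow_zero, Ideal.absNorm_eq_one_iff] at hf
    exact Ideal.IsMaximal.ne_top inferInstance hf
  choose f hf0 hf using hpow
  rw [hf, hf, hf, hf, ← pow_add, ← pow_add, ← pow_mul, ← pow_add,
    Nat.pow_dvd_pow_iff_le_right hp.one_lt] at hN
  have := hf0 0
  have := hf0 1
  have := hf0 2
  have := hf0 3
  have hi : f i = 1 := by fin_cases i <;> simp <;> omega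
  rw [hf, hi, pow_one]

end General

section Trinomial

variable {K : Type*} [Field K] [NumberField K]

theorem exists_basis_pow_eq {f : ℚ[X]} {n : ℕ} (hirr : Irreducible f) (hmonic : f.Monic)
    (hdeg : f.natDegree = n) {α : K} (hroot : aeval α f = 0)
    (hgen : Algebra.adjoin ℚ ({α} : Set K) = ⊤) :
    ∃ B : Module.Basis (Fin n) ℚ K, ∀ i, B i = α ^ (i : ℕ) := by
  have hint : IsIntegral ℚ α := Algebra.IsIntegral.isIntegral α
  let pb := PowerBasis.ofAdjoinEqTop hint hgen
  have hgen' : pb.gen = α := PowerBasis.ofAdjoinEqTop_gen hint hgen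
  have hdim : pb.dim = n := by
    rw [← hdeg, minpoly.eq_of_irreducible_of_monic hirr hroot hmonic, ← hgen',
      PowerBasis.natDegree_minpoly]
  exact ⟨pb.basis.reindex (finCongr hdim), fun i ↦ by simp [hgen']⟩

theorem trace_eq_of_mul_eq {n : ℕ} (B : Module.Basis (Fin n) ℚ K) {x : K}
    (M : Matrix (Fin n) (Fin n) ℚ) (h : ∀ j, x * B j = ∑ i, M j i • B i) :
    Algebra.trace ℚ K x = ∑ j, M j j := by
  rw [Algebra.trace_eq_matrix_trace B, Matrix.trace]
  refine Finset.sum_congr rfl fun j _ ↦ ?_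
  rw [Matrix.diag_apply, Algebra.leftMulMatrix_eq_repr_mul, h, B.repr_sum_self]

theorem trace_of_trinomial_root {a b : ℚ} {α : K} (hroot : α ^ 5 + (a : K) * α ^ 2 + (b : K) = 0)
    (B : Module.Basis (Fin 5) ℚ K) (hB : ∀ i, B i = α ^ (i : ℕ)) (c₀ c₁ c₂ c₃ c₄ : ℚ) :
    Algebra.trace ℚ K (c₀ + c₁ * α + c₂ * α ^ 2 + c₃ * α ^ 3 + c₄ * α ^ 4) =
      5 * c₀ - 3 * a * c₃ := by
  rw [trace_eq_of_mul_eq B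
    !![c₀, c₁, c₂, c₃, c₄;
       -b * c₄, c₀, c₁ - a * c₄, c₂, c₃;
       -b * c₃, -b * c₄, c₀ - a * c₃, c₁ - a * c₄, c₂;
       -b * c₂, -b * c₃, -b * c₄ - a * c₂, c₀ - a * c₃, c₁ - a * c₄;
       -b * (c₁ - a * c₄), -b * c₂, -b * c₃ - a * (c₁ - a * c₄), -b * c₄ - a * c₂, c₀ - a * c₃]]
  · simp [Fin.sum_univ_five]
    ring
  · intro j
    fin_cases j <;> simp [Fin.sum_univ_five, hB, Algebra.smul_def]
    · linear_combination (c₄ : K) * hroot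
    · linear_combination (c₃ + c₄ * α : K) * hroot
    · linear_combination (c₂ + c₃ * α + c₄ * α ^ 2 : K) * hroot
    · linear_combination (c₁ - a * c₄ + c₂ * α + c₃ * α ^ 2 + c₄ * α ^ 3 : K) * hroot

end Trinomial

section Relations

variable {R : Type*} [CommRing R] [IsDomain R] {a b e α δ : R}

theorem mul_cube_add_eq (h3 : (3 : R) ≠ 0) (hroot : α ^ 5 + a * α ^ 2 + 9 * b = 0)
    (hδ : 3 * δ = α ^ 2 * (α + a) ^ 2) : δ * (α ^ 3 + a) = -3 * b * (α + a) ^ 2 := by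
  refine mul_left_cancel₀ h3 ?_
  linear_combination (α ^ 3 + a) * hδ + (α + a) ^ 2 * hroot

theorem quadratic_relation (h3 : (3 : R) ≠ 0) (ha : a ^ 2 = 1 + 9 * e)
    (hroot : α ^ 5 + a * α ^ 2 + 9 * b = 0) (hδ : 3 * δ = α ^ 2 * (α + a) ^ 2) :
    δ * (δ * (α ^ 2 - 3 * a * α + 6 * a ^ 2) +
      α ^ 2 * (-3 * a * (1 + 10 * e) * (α + a) + a ^ 2 * (1 + 15 * e))) =
      -(b - a ^ 3 * e) * (α + a) * α ^ 4 := by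
  refine mul_left_cancel₀ (pow_ne_zero 2 h3) ?_
  linear_combination α ^ 4 * (α + a) * hroot +
    ((3 * δ + α ^ 2 * (α + a) ^ 2) * (α ^ 2 - 3 * a * α + 6 * a ^ 2) +
      3 * α ^ 2 * (-3 * a * (1 + 10 * e) * (α + a) + a ^ 2 * (1 + 15 * e))) * hδ +
    (α ^ 4 * (α + a) ^ 2 * (10 * a * (α + a) - 5 * a ^ 2) + α ^ 4 * (α + a) * a ^ 3) * ha

theorem exists_monic_quadratic (h3 : (3 : R) ≠ 0) (ha : a ^ 2 = 1 + 9 * e)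
    (hroot : α ^ 5 + a * α ^ 2 + 9 * b = 0) (hδ : 3 * δ = α ^ 2 * (α + a) ^ 2) :
    δ ^ 2 + (3 * a * b * (α + a) ^ 2 -
      a * α ^ 3 * (-3 * a * (1 + 10 * e) * (α + a) + a ^ 2 * (1 + 15 * e)) +
      α ^ 2 * (α + a) ^ 2 * (3 * e + a ^ 2 * α ^ 2 - 2 * a ^ 3 * α)) * δ +
      -(a * (b - a ^ 3 * e) * (α + a) * α ^ 5) = 0 := by
  linear_combination a * δ * mul_cube_add_eq h3 hroot hδ -
    a * α * quadratic_relation h3 ha hroot hδ -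
    (3 * e + a ^ 2 * α ^ 2 - 2 * a ^ 3 * α) * δ * hδ - δ ^ 2 * ha

end Relations

section Residue

variable {R : Type*} [CommRing R] [IsDomain R] {a b e α δ : R}

theorem eq_neg_one_and_sq_eq_one (h3 : (3 : R) = 0) (ha : a ^ 2 = 1)
    (hδ : δ * (α ^ 3 + a) = -3 * b * (α + a) ^ 2)
    (hquad : δ * (δ * (α ^ 2 - 3 * a * α + 6 * a ^ 2) +
      α ^ 2 * (-3 * a * (1 + 10 * e) * (α + a) + a ^ 2 * (1 + 15 * e))) =
      -(b - a ^ 3 * e) * (α + a) * α ^ 4) (h : δ ≠ 0) : δ = -1 ∧ α ^ 2 = 1 := by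
  have hα3 : α ^ 3 + a = 0 := by
    refine (mul_eq_zero.mp (?_ : δ * (α ^ 3 + a) = 0)).resolve_left h
    linear_combination hδ - b * (α + a) ^ 2 * h3
  have hα : α + a = 0 := by
    refine pow_eq_zero_iff (n := 3) (by norm_num) |>.mp ?_
    linear_combination hα3 + a * ha + α * a * (α + a) * h3
  have hα2 : α ^ 2 = 1 := by linear_combination (α - a) * hα + ha
  refine ⟨?_, hα2⟩
  have hδ1 : δ * (δ + 1) = 0 := by
    obtain rfl : α = -a := by linear_combination hα
    linear_combination hquad - δ * δ * ha - δ * (a ^ 2 + 1) * ha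
      - δ * (3 * δ * a ^ 2 + 5 * a ^ 4 * e) * h3
  linear_combination (mul_eq_zero.mp hδ1).resolve_left h

omit [IsDomain R] in
theorem add_one_mem_and_sq_sub_one_mem {P : Ideal R} [P.IsPrime] (h3 : (3 : R) ∈ P)
    (ha : a ^ 2 - 1 ∈ P) (hδ : δ * (α ^ 3 + a) = -3 * b * (α + a) ^ 2)
    (hquad : δ * (δ * (α ^ 2 - 3 * a * α + 6 * a ^ 2) +
      α ^ 2 * (-3 * a * (1 + 10 * e) * (α + a) + a ^ 2 * (1 + 15 * e))) =
      -(b - a ^ 3 * e) * (α + a) * α ^ 4) (h : δ ∉ P) : δ + 1 ∈ P ∧ α ^ 2 - 1 ∈ P := by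
  let q := Ideal.Quotient.mk P
  have hq : ∀ x, x ∈ P ↔ q x = 0 := fun x ↦ Ideal.Quotient.eq_zero_iff_mem.symm
  simp only [hq, map_sub, map_add, map_pow, map_one, map_ofNat] at h3 ha h ⊢
  have hδ' := congrArg q hδ
  have hquad' := congrArg q hquad
  simp only [map_mul, map_sub, map_add, map_neg, map_pow, map_one, map_ofNat] at hδ' hquad'
  obtain ⟨h₁, h₂⟩ := eq_neg_one_and_sq_eq_one h3 (sub_eq_zero.mp ha) hδ' hquad' h
  exact ⟨by rw [h₁, neg_add_cancel], sub_eq_zero.mpr h₂⟩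

omit [IsDomain R] in
theorem sq_sub_one_mem {c γ : R} {P : Ideal R} [P.IsPrime] (hac : a * c + 1 ∈ P)
    (hαγ : α * γ ∈ P) (hγ : γ ^ 2 = -c * (α ^ 3 + a)) (h : γ ∉ P) : γ ^ 2 - 1 ∈ P := by
  have hα : α ∈ P := (Ideal.IsPrime.mem_or_mem inferInstance hαγ).resolve_right h
  have h1 : γ ^ 2 - 1 = -c * α ^ 2 * α - (a * c + 1) := by linear_combination hγ
  rw [h1]
  exact sub_mem (Ideal.mul_mem_left _ _ hα) hac

end Residue

section Construction

variable {K : Type*} [Field K] [NumberField K]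

omit [NumberField K] in
theorem isIntegral_of_quadratic {x : K} {p q : 𝓞 K} (h : x ^ 2 + (p : K) * x + (q : K) = 0) :
    IsIntegral ℤ x := by
  refine isIntegral_trans (A := 𝓞 K) x ⟨X ^ 2 + C p * X + C q, by monicity!, ?_⟩
  simpa [eval₂_add, eval₂_mul] using h

theorem exists_integral_elements {a b c e : ℤ} {k : ℕ} {α : K} (ha : a ^ 2 = 1 + 9 * e)
    (hb : 9 * b = 9 ^ k * c) (hroot : α ^ 5 + (a : K) * α ^ 2 + 9 * (b : K) = 0) :
    ∃ A γ δ : 𝓞 K, (A : K) = α ∧ A ^ 5 + (a : 𝓞 K) * A ^ 2 + 9 * (b : 𝓞 K) = 0 ∧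
      3 ^ k * γ = A * (A ^ 3 + (a : 𝓞 K)) ∧ A * γ = -3 ^ k * (c : 𝓞 K) ∧
      γ ^ 2 = -(c : 𝓞 K) * (A ^ 3 + (a : 𝓞 K)) ∧ 3 * δ = A ^ 2 * (A + (a : 𝓞 K)) ^ 2 := by
  have h3 : (3 : K) ^ k ≠ 0 := pow_ne_zero _ three_ne_zero
  have h9 : (9 : K) ^ k = 3 ^ k * 3 ^ k := by rw [← mul_pow]; norm_num
  have hb' : 9 * (b : K) = 3 ^ k * 3 ^ k * c := by
    rw [← h9]; exact_mod_cast congrArg (Int.cast (R := K)) hb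
  have ha' : (a : K) ^ 2 = 1 + 9 * e := by exact_mod_cast congrArg (Int.cast (R := K)) ha
  have hα : IsIntegral ℤ α := by
    refine ⟨X ^ 5 + C a * X ^ 2 + C (9 * b), by monicity!, ?_⟩
    rw [← aeval_def]
    simpa [map_ofNat] using hroot
  obtain ⟨A, rfl⟩ : ∃ A : 𝓞 K, (A : K) = α := ⟨⟨α, hα⟩, rfl⟩
  obtain ⟨g, hg⟩ : ∃ g : K, 3 ^ k * g = (A : K) * ((A : K) ^ 3 + a) := ⟨_, mul_div_cancel₀ _ h3⟩
  have hAg : (A : K) * g = -3 ^ k * c := by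
    refine mul_left_cancel₀ h3 ?_
    linear_combination (A : K) * hg + hroot - hb'
  have hg2 : g ^ 2 = -c * ((A : K) ^ 3 + a) := by
    refine mul_left_cancel₀ h3 ?_
    linear_combination g * hg + ((A : K) ^ 3 + a) * hAg
  obtain ⟨d, hd⟩ : ∃ d : K, 3 * d = (A : K) ^ 2 * ((A : K) + a) ^ 2 := ⟨_, mul_div_cancel₀ _ three_ne_zero⟩
  have hgi : IsIntegral ℤ g := by
    refine IsIntegral.of_pow (n := 2) (by norm_num) ?_
    rw [hg2]
    exact (-(c : 𝓞 K) * (A ^ 3 + (a : 𝓞 K))).isIntegral_coe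
  have hdi : IsIntegral ℤ d := by
    refine isIntegral_of_quadratic (p := 3 * a * b * (A + a) ^ 2 -
      a * A ^ 3 * (-3 * a * (1 + 10 * e) * (A + a) + a ^ 2 * (1 + 15 * e)) +
      A ^ 2 * (A + a) ^ 2 * (3 * e + a ^ 2 * A ^ 2 - 2 * a ^ 3 * A))
      (q := -(a * (b - a ^ 3 * e) * (A + a) * A ^ 5)) ?_
    simpa [map_ofNat] using exists_monic_quadratic three_ne_zero ha' hroot hd
  obtain ⟨γ, rfl⟩ : ∃ γ : 𝓞 K, (γ : K) = g := ⟨⟨g, hgi⟩, rfl⟩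
  obtain ⟨δ, rfl⟩ : ∃ δ : 𝓞 K, (δ : K) = d := ⟨⟨d, hdi⟩, rfl⟩
  refine ⟨A, γ, δ, rfl, ?_, ?_, ?_, ?_, ?_⟩ <;> apply RingOfIntegers.coe_injective
  · simpa [map_ofNat] using hroot
  · simpa [map_ofNat] using hg
  · simpa [map_ofNat] using hAg
  · simpa [map_ofNat] using hg2
  · simpa [map_ofNat] using hd

end Construction

section Splitting

variable {K : Type*} [Field K] [NumberField K]

theorem exists_four_ringHom {a b c e : ℤ} {k : ℕ} {α : K} (hk : 0 < k) (ha : a ^ 2 = 1 + 9 * e)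
    (hb : 9 * b = 9 ^ k * c) (hac : ((a * c : ℤ) : ZMod 3) = -1)
    (hroot : α ^ 5 + (a : K) * α ^ 2 + 9 * (b : K) = 0)
    (B : Module.Basis (Fin 5) ℚ K) (hB : ∀ i, B i = α ^ (i : ℕ)) :
    ∃ φ : Fin 4 → 𝓞 K →+* ZMod 3, Function.Injective φ := by
  have hcop : ∀ x : ℤ, (x : ZMod 3) ≠ 0 → ¬ ((3 : ℕ) : ℤ) ∣ x := fun x hx ↦
    mt (ZMod.intCast_zmod_eq_zero_iff_dvd x 3).mpr hx
  have ha3 : ((a ^ 2 : ℤ) : ZMod 3) = 1 := by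
    rw [ha]
    push_cast
    rw [show (9 : ZMod 3) = 0 from rfl, zero_mul, add_zero]
  obtain ⟨A, γ, δ, rfl, h1, hγ, hAγ, hγ2, hδ⟩ := exists_integral_elements ha hb hroot
  have hroot' : (A : K) ^ 5 + ((a : ℚ) : K) * (A : K) ^ 2 + ((9 * b : ℚ) : K) = 0 := by
    push_cast
    exact hroot
  have h3 : (3 : 𝓞 K) ≠ 0 := by exact_mod_cast (by norm_num : (3 : ℕ) ≠ 0)
  have ha' : (a : 𝓞 K) ^ 2 = 1 + 9 * e := by exact_mod_cast congrArg (Int.cast (R := 𝓞 K)) ha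
  have hδA := mul_cube_add_eq h3 h1 hδ
  have hquad := quadratic_relation h3 ha' h1 hδ
  have htr := trace_of_trinomial_root hroot' B hB
  have hγK : (γ : K) = ((0 : ℚ) : K) + ((a / 3 ^ k : ℚ) : K) * A + ((0 : ℚ) : K) * A ^ 2 +
      ((0 : ℚ) : K) * A ^ 3 + ((1 / 3 ^ k : ℚ) : K) * A ^ 4 := by
    have := congrArg (algebraMap (𝓞 K) K) hγ
    simp only [map_mul, map_add, map_pow, map_intCast, map_ofNat] at this
    push_cast
    field_simp
    linear_combination this
  have hγ2K : (γ : K) ^ 2 = ((-c * a : ℚ) : K) + ((0 : ℚ) : K) * A + ((0 : ℚ) : K) * A ^ 2 +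
      ((-c : ℚ) : K) * A ^ 3 + ((0 : ℚ) : K) * A ^ 4 := by
    have := congrArg (algebraMap (𝓞 K) K) hγ2
    simp only [map_mul, map_add, map_neg, map_pow, map_intCast] at this
    push_cast
    linear_combination this
  have hδK : (δ : K) = ((0 : ℚ) : K) + ((0 : ℚ) : K) * A + ((a ^ 2 / 3 : ℚ) : K) * A ^ 2 +
      ((2 * a / 3 : ℚ) : K) * A ^ 3 + ((1 / 3 : ℚ) : K) * A ^ 4 := by
    have := congrArg (algebraMap (𝓞 K) K) hδ
    simp only [map_mul, map_add, map_pow, map_intCast, map_ofNat] at this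
    push_cast
    linear_combination this / 3
  have hA2K : (A : K) ^ 2 = ((0 : ℚ) : K) + ((0 : ℚ) : K) * A + ((1 : ℚ) : K) * A ^ 2 +
      ((0 : ℚ) : K) * A ^ 3 + ((0 : ℚ) : K) * A ^ 4 := by
    push_cast
    ring
  have htγ : ((-2 * (a * c) : ℤ) : ZMod 3) ≠ 0 := by
    rw [Int.cast_mul, hac]; decide
  have htδ : ((-2 * a ^ 2 : ℤ) : ZMod 3) ≠ 0 := by
    rw [Int.cast_mul, ha3]; decide
  have ht₁ : Algebra.trace ℚ K ((γ ^ 2 + γ : 𝓞 K) : K) = (-2 * (a * c) : ℤ) := by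
    rw [show ((γ ^ 2 + γ : 𝓞 K) : K) = (γ : K) ^ 2 + (γ : K) from rfl, map_add, hγ2K, hγK,
      htr, htr]
    push_cast; ring
  have ht₂ : Algebra.trace ℚ K ((γ ^ 2 - γ : 𝓞 K) : K) = (-2 * (a * c) : ℤ) := by
    rw [show ((γ ^ 2 - γ : 𝓞 K) : K) = (γ : K) ^ 2 - (γ : K) from rfl, map_sub, hγ2K, hγK,
      htr, htr]
    push_cast; ring
  have ht₃ : Algebra.trace ℚ K ((A ^ 2 + δ : 𝓞 K) : K) = (-2 * a ^ 2 : ℤ) := by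
    rw [show ((A ^ 2 + δ : 𝓞 K) : K) = (A : K) ^ 2 + (δ : K) from rfl, map_add, hA2K, hδK,
      htr, htr]
    push_cast; ring
  have ht₄ : Algebra.trace ℚ K (δ : K) = (-2 * a ^ 2 : ℤ) := by
    rw [hδK, htr]; push_cast; ring
  obtain ⟨P₁, hP₁, h3P₁, hz₁⟩ := exists_isMaximal_of_not_dvd_trace ht₁ (hcop _ htγ)
  obtain ⟨P₂, hP₂, h3P₂, hz₂⟩ := exists_isMaximal_of_not_dvd_trace ht₂ (hcop _ htγ)
  obtain ⟨P₃, hP₃, h3P₃, hz₃⟩ := exists_isMaximal_of_not_dvd_trace ht₃ (hcop _ htδ)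
  obtain ⟨P₄, hP₄, h3P₄, hz₄⟩ := exists_isMaximal_of_not_dvd_trace ht₄ (hcop _ htδ)
  have hmem : ∀ {P : Ideal (𝓞 K)}, ((3 : ℕ) : 𝓞 K) ∈ P → ∀ x : ℤ, (x : ZMod 3) = 0 →
      (x : 𝓞 K) ∈ P := by
    intro P hP x hx
    obtain ⟨y, rfl⟩ := (ZMod.intCast_zmod_eq_zero_iff_dvd x 3).mp hx
    rw [Int.cast_mul, Int.cast_natCast]
    exact P.mul_mem_right _ hP
  have hαγ : ∀ {P : Ideal (𝓞 K)}, ((3 : ℕ) : 𝓞 K) ∈ P → A * γ ∈ P := by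
    intro P hP
    have := hmem hP (-3 ^ k * c) (by
      push_cast; rw [show (3 : ZMod 3) = 0 from rfl, zero_pow hk.ne', neg_zero, zero_mul])
    rw [hAγ]
    simpa using this
  have hγsq : ∀ {P : Ideal (𝓞 K)} [P.IsMaximal], ((3 : ℕ) : 𝓞 K) ∈ P → γ ∉ P →
      (γ + 1) * (γ - 1) ∈ P := by
    intro P _ hP h
    have hac' : (a : 𝓞 K) * c + 1 ∈ P := by
      have := hmem hP (a * c + 1) (by rw [Int.cast_add, hac]; rfl)
      simpa using this
    have := sq_sub_one_mem hac' (hαγ hP) hγ2 h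
    convert this using 1
    ring
  have hδres : ∀ {P : Ideal (𝓞 K)} [P.IsMaximal], ((3 : ℕ) : 𝓞 K) ∈ P → δ ∉ P →
      δ + 1 ∈ P ∧ A ^ 2 - 1 ∈ P := by
    intro P _ hP h
    have ha1 : (a : 𝓞 K) ^ 2 - 1 ∈ P := by
      have := hmem hP (a ^ 2 - 1) (by rw [Int.cast_sub, ha3]; rfl)
      simpa using this
    exact add_one_mem_and_sq_sub_one_mem (by exact_mod_cast hP) ha1 hδA hquad h
  have hγ₁ : γ ∉ P₁ := fun h ↦ hz₁ (add_mem (Ideal.pow_mem_of_mem _ h 2 two_pos) h)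
  have hγ₂ : γ ∉ P₂ := fun h ↦ hz₂ (sub_mem (Ideal.pow_mem_of_mem _ h 2 two_pos) h)
  have hγ₁' : γ + 1 ∉ P₁ := fun h ↦ hz₁ (by
    convert P₁.mul_mem_left γ h using 1; ring)
  have hγ₂' : γ + 1 ∈ P₂ := (Ideal.IsPrime.mem_or_mem inferInstance (hγsq h3P₂ hγ₂)).resolve_right
    fun h ↦ hz₂ (by convert P₂.mul_mem_left γ h using 1; ring)
  have hδ₃ : δ ∈ P₃ := by
    by_contra h
    obtain ⟨h₁, h₂⟩ := hδres h3P₃ h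
    refine hz₃ ?_
    convert add_mem h₁ h₂ using 1
    ring
  have hγ₃ : γ ∈ P₃ := (Ideal.IsPrime.mem_or_mem inferInstance (hαγ h3P₃)).resolve_left
    fun h ↦ hz₃ (add_mem (Ideal.pow_mem_of_mem _ h 2 two_pos) hδ₃)
  have hγ₄ : γ ∈ P₄ := (Ideal.IsPrime.mem_or_mem inferInstance (hαγ h3P₄)).resolve_left
    fun h ↦ hP₄.ne_top <| (Ideal.eq_top_iff_one _).mpr <| by
      convert sub_mem (Ideal.pow_mem_of_mem _ h 2 two_pos) (hδres h3P₄ hz₄).2 using 1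
      ring
  let P : Fin 4 → Ideal (𝓞 K) := ![P₁, P₂, P₃, P₄]
  have hmax : ∀ i, (P i).IsMaximal := by
    intro i; fin_cases i <;> assumption
  have h3P : ∀ i, ((3 : ℕ) : 𝓞 K) ∈ P i := by
    intro i; fin_cases i <;> assumption
  have hinj : Function.Injective P := by
    have h12 : P₁ ≠ P₂ := fun h ↦ hγ₁' (h ▸ hγ₂')
    have h13 : P₁ ≠ P₃ := fun h ↦ hγ₁ (h ▸ hγ₃)
    have h14 : P₁ ≠ P₄ := fun h ↦ hγ₁ (h ▸ hγ₄)
    have h23 : P₂ ≠ P₃ := fun h ↦ hγ₂ (h ▸ hγ₃)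
    have h24 : P₂ ≠ P₄ := fun h ↦ hγ₂ (h ▸ hγ₄)
    have h34 : P₃ ≠ P₄ := fun h ↦ hz₄ (h ▸ hδ₃)
    intro i j h
    fin_cases i <;> fin_cases j <;> first
      | rfl
      | exact absurd h ‹_›
      | exact absurd h.symm ‹_›
  have hK : Module.finrank ℚ K = 5 := by simp [Module.finrank_eq_card_basis B]
  have hram : ((3 : ℕ) : 𝓞 K) ∈ P 3 ^ 2 :=
    natCast_mem_sq_of_sq_eq (ν := A * (A + a)) (h3P 3) (by push_cast; rw [hδ]; ring) hz₄
  choose φ hφ using fun i ↦ exists_ringHom_ker_eq Nat.prime_three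
    (absNorm_eq_of_ramified Nat.prime_three hK hinj h3P hram i)
  exact ⟨φ, fun i j h ↦ hinj (by rw [← hφ i, ← hφ j, h])⟩

end Splitting

theorem stmt_15 (a b : ℤ) (k : ℕ) (hk : 0 < k)
    (hirr : Irreducible (X ^ 5 + C (a : ℚ) * X ^ 2 + C (b : ℚ)))
    (hb : padicValInt 3 b = 2 * k)
    (ha : a ≡ 1 [ZMOD 9] ∨ a ≡ -1 [ZMOD 9])
    (hcong : (b / 3 ^ (2 * k)) * a ≡ -1 [ZMOD 3])
    (K : Type*) [Field K] [NumberField K] (α : K)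
    (hroot : α ^ 5 + (a : K) * α ^ 2 + (b : K) = 0)
    (hgen : Algebra.adjoin ℚ ({α} : Set K) = ⊤) :
    IsCommonIndexDivisor 3 K ∧ ¬ IsMonogenic K := by
  obtain ⟨e, he⟩ : ∃ e : ℤ, a ^ 2 = 1 + 9 * e := by
    have h : a ^ 2 ≡ 1 [ZMOD 9] := by
      rcases ha with h | h <;> simpa using h.pow 2
    obtain ⟨e, he⟩ := h.symm.dvd
    exact ⟨e, by linear_combination he⟩
  obtain ⟨c, hc⟩ : (3 : ℤ) ^ (2 * k) ∣ b := by
    have := padicValInt_dvd (p := 3) b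
    rwa [hb] at this
  have hac : ((a * c : ℤ) : ZMod 3) = -1 := by
    rw [hc, Int.mul_ediv_cancel_left _ (by positivity)] at hcong
    have := (ZMod.intCast_eq_intCast_iff _ _ 3).mpr hcong
    rw [mul_comm, this]
    rfl
  obtain ⟨j, rfl⟩ : ∃ j, k = j + 1 := ⟨k - 1, by omega⟩
  have hb9 : b = 9 * (9 ^ j * c) := by
    rw [hc, pow_mul]; ring
  have hdeg : (X ^ 5 + C (a : ℚ) * X ^ 2 + C (b : ℚ)).natDegree = 5 := by compute_degree!
  obtain ⟨B, hB⟩ := exists_basis_pow_eq hirr (by monicity!) hdeg (by simpa using hroot) hgen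
  obtain ⟨φ, hφ⟩ := exists_four_ringHom hk he (b := 9 ^ j * c) (by ring) hac
    (by rw [hb9] at hroot; push_cast at hroot ⊢; exact hroot) B hB
  have hdvd := dvd_subIndex_of_injective_s15 (p := 3) (by simp) hφ
  exact ⟨fun θ _ ↦ hdvd θ, not_isMonogenic_of_isCommonIndexDivisor Nat.prime_three hdvd⟩
end

section
/- Let K be the number field defined by an irreducible trinomial x^5 + a x^2 + b with a ≡ ±4 (mod 9) and 3 ∤ a. Then 3 is not a common index divisor of K. -/
open Polynomial NumberField

/-- Lying over for `ℤ[θ] ⊆ 𝓞 K`: an irreducible factor of the reduction of the minimal polynomial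
of `θ` gives a prime ideal of `𝓞 K`. -/
lemma exists_ideal_aeval_mem_iff {K : Type*} [Field K] [NumberField K] {p : ℕ} [Fact p.Prime]
    (θ : 𝓞 K) {π : (ZMod p)[X]} (hπ : Irreducible π)
    (hdvd : π ∣ (minpoly ℤ θ).map (Int.castRingHom (ZMod p))) :
    ∃ Q : Ideal (𝓞 K), ∀ q : ℤ[X],
      aeval θ q ∈ Q ↔ π ∣ q.map (Int.castRingHom (ZMod p)) := by
  let f : ℤ[X] →+* 𝓞 K := (aeval θ).toRingHom
  let : Algebra ℤ[X] (𝓞 K) := f.toAlgebra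
  have : IsScalarTower ℤ ℤ[X] (𝓞 K) :=
    IsScalarTower.of_algebraMap_eq fun n => ((aeval θ).commutes n).symm
  have : Algebra.IsIntegral ℤ[X] (𝓞 K) := Algebra.IsIntegral.tower_top (R := ℤ)
  let P : Ideal ℤ[X] := (Ideal.span {π}).comap (mapRingHom (Int.castRingHom (ZMod p)))
  have : (Ideal.span {π}).IsPrime :=
    (Ideal.span_singleton_prime hπ.ne_zero).2 hπ.prime
  have : P.IsPrime := Ideal.comap_isPrime _ _
  have hP : RingHom.ker (algebraMap ℤ[X] (𝓞 K)) ≤ P := by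
    intro q hq
    have h0 : aeval θ q = 0 := hq
    have h1 := minpoly.isIntegrallyClosed_dvd (RingOfIntegers.isIntegral θ) h0
    exact Ideal.mem_span_singleton.2 (hdvd.trans (Polynomial.map_dvd _ h1))
  obtain ⟨Q, -, hQ⟩ := Ideal.exists_ideal_over_prime_of_isIntegral_of_isDomain P hP
  refine ⟨Q, fun q => ?_⟩
  have h1 : q ∈ Q.comap (algebraMap ℤ[X] (𝓞 K)) ↔ q ∈ P := by rw [hQ]
  exact h1.trans Ideal.mem_span_singleton

/-- The nontrivial direction of Dedekind's criterion, when the repeated factors modulo `p` are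
linear. -/
lemma mem_adjoin_of_mul_mem_adjoin {K : Type*} [Field K] [NumberField K] {p : ℕ} [Fact p.Prime]
    (θ : 𝓞 K)
    (hsq : ∀ π : (ZMod p)[X], Irreducible π →
      π ^ 2 ∣ (minpoly ℤ θ).map (Int.castRingHom (ZMod p)) →
      ∃ r : ℤ, π ∣ X - C (r : ZMod p) ∧ ¬ (p : ℤ) ^ 2 ∣ (minpoly ℤ θ).eval r)
    {x : 𝓞 K} (hx : (p : 𝓞 K) * x ∈ Algebra.adjoin ℤ ({θ} : Set (𝓞 K))) :
    x ∈ Algebra.adjoin ℤ ({θ} : Set (𝓞 K)) := by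
  have hp0 : (p : 𝓞 K) ≠ 0 := Nat.cast_ne_zero.2 (Fact.out : p.Prime).ne_zero
  set g := minpoly ℤ θ with hg
  have hgθ : aeval θ g = 0 := minpoly.aeval ℤ θ
  have hgm : g.Monic := minpoly.monic (RingOfIntegers.isIntegral θ)
  let φ : ℤ[X] →+* (ZMod p)[X] := mapRingHom (Int.castRingHom (ZMod p))
  have hφ : Function.Surjective φ := map_surjective _ (ZMod.intCast_surjective)
  have hker : ∀ q : ℤ[X], φ q = 0 → ∃ s : ℤ[X], q = C (p : ℤ) * s := by
    intro q hq
    refine (C_dvd_iff_dvd_coeff _ _).2 fun i => ?_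
    have h1 : (φ q).coeff i = 0 := by rw [hq, coeff_zero]
    rw [coe_mapRingHom, coeff_map] at h1
    exact (ZMod.intCast_zmod_eq_zero_iff_dvd _ _).1 h1
  have hCp : ∀ s : ℤ[X], aeval θ (C (p : ℤ) * s) = (p : 𝓞 K) * aeval θ s := by
    intro s; simp
  let I : Ideal ℤ[X] := (Ideal.span {(p : 𝓞 K)}).comap (aeval θ).toRingHom
  have hI : ∀ q : ℤ[X], q ∈ I ↔ ∃ y, aeval θ q = (p : 𝓞 K) * y :=
    fun q => Ideal.mem_span_singleton
  obtain ⟨d, hd⟩ := (IsPrincipalIdealRing.principal (I.map φ)).principal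
  have hmem : ∀ q, q ∈ I → d ∣ φ q := fun q hq => by
    have h1 := Ideal.mem_map_of_mem φ hq
    rw [hd] at h1
    exact Ideal.mem_span_singleton.1 h1
  obtain ⟨e, he⟩ := hmem g ((hI g).2 ⟨0, by rw [hgθ, mul_zero]⟩)
  by_cases hu : IsUnit e
  · obtain ⟨q, hq⟩ := Algebra.adjoin_singleton_eq_range_aeval ℤ θ ▸ hx
    have hq' : aeval θ q = (p : 𝓞 K) * x := hq
    have hgq : φ g ∣ φ q := by
      rw [he]
      exact (hu.mul_right_dvd).2 (hmem q ((hI q).2 ⟨x, hq'⟩))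
    obtain ⟨s, hs⟩ := hgq
    obtain ⟨s, rfl⟩ := hφ s
    obtain ⟨t, ht⟩ := hker (q - g * s) (by rw [map_sub, map_mul, hs, sub_self])
    have h2 : aeval θ (q - g * s) = (p : 𝓞 K) * aeval θ t := by rw [ht, hCp]
    rw [map_sub, map_mul, hgθ, zero_mul, sub_zero, hq'] at h2
    rw [mul_left_cancel₀ hp0 h2]
    exact aeval_mem_adjoin_singleton ℤ θ
  · exfalso
    have hφg : φ g ≠ 0 := (hgm.map _).ne_zero
    have he0 : e ≠ 0 := by rintro rfl; exact hφg (by rw [he, mul_zero])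
    obtain ⟨π, hπ, s, rfl⟩ := WfDvdMonoid.exists_irreducible_factor hu he0
    have hw : d * s ∈ I.map φ := by
      rw [hd]; exact Ideal.mem_span_singleton.2 (dvd_mul_right d s)
    obtain ⟨w, hwI, hw⟩ := (Ideal.mem_map_iff_of_surjective φ hφ).1 hw
    obtain ⟨ϖ, hϖ⟩ := hφ π
    obtain ⟨y, hy⟩ := (hI w).1 hwI
    have hfac : φ g = φ w * π := by rw [he, hw]; ring
    obtain ⟨h, hh⟩ := hker (g - w * ϖ) (by rw [map_sub, map_mul, hϖ, hfac, sub_self])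
    have hhθ : aeval θ h = -(y * aeval θ ϖ) := by
      have h2 : aeval θ (g - w * ϖ) = (p : 𝓞 K) * aeval θ h := by rw [hh, hCp]
      rw [map_sub, map_mul, hgθ, hy] at h2
      exact mul_left_cancel₀ hp0 (by linear_combination -h2)
    obtain ⟨Q, hQ⟩ := exists_ideal_aeval_mem_iff θ hπ (by
      have h1 : map (Int.castRingHom (ZMod p)) g = φ w * π := hfac
      rw [h1]; exact dvd_mul_left π (φ w))
    have hpQ : (p : 𝓞 K) ∈ Q := by
      have h1 := (hQ (C (p : ℤ))).2 (by simp)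
      simpa using h1
    have hϖQ : aeval θ ϖ ∈ Q := (hQ ϖ).2 (by
      have h1 : map (Int.castRingHom (ZMod p)) ϖ = π := hϖ
      rw [h1])
    have hπw : π ∣ φ w := (hQ w).1 (by rw [hy]; exact Q.mul_mem_right _ hpQ)
    have hπh : π ∣ φ h := (hQ h).1 (by
      rw [hhθ]; exact Q.neg_mem (Q.mul_mem_left _ hϖQ))
    obtain ⟨r, hr, hrg⟩ := hsq π hπ (by
      have h1 : map (Int.castRingHom (ZMod p)) g = φ w * π := hfac
      rw [h1, pow_two]; exact mul_dvd_mul_right hπw π)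
    have hroot : (X - C (r : ZMod p)) ∣ π :=
      (hπ.dvd_symm (irreducible_X_sub_C _) hr)
    have hdvd : ∀ q : ℤ[X], π ∣ φ q → (p : ℤ) ∣ q.eval r := fun q hq => by
      have h1 : (φ q).eval (r : ZMod p) = 0 := dvd_iff_isRoot.1 (hroot.trans hq)
      have h2 : (φ q).eval (r : ZMod p) = ((q.eval r : ℤ) : ZMod p) := by
        simp [φ]
      exact (ZMod.intCast_zmod_eq_zero_iff_dvd _ _).1 (h2 ▸ h1)
    apply hrg
    have h3 : g = w * ϖ + C (p : ℤ) * h := by rw [← hh]; ring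
    rw [h3, eval_add, eval_mul, eval_mul, eval_C, pow_two]
    exact dvd_add (mul_dvd_mul (hdvd w hπw) (hdvd ϖ (by rw [hϖ])))
      (mul_dvd_mul_left _ (hdvd h hπh))

/-- If `θ` generates `K` and `𝓞 K ⧸ ℤ[θ]` has no `p`-torsion, then `p` does not divide the index
of `θ`. -/
lemma not_dvd_subIndex {K : Type*} [Field K] [NumberField K] {p : ℕ} [Fact p.Prime] (θ : 𝓞 K)
    (hgen : Algebra.adjoin ℚ ({(θ : K)} : Set K) = ⊤)
    (htor : ∀ x : 𝓞 K, (p : 𝓞 K) * x ∈ Algebra.adjoin ℤ ({θ} : Set (𝓞 K)) →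
      x ∈ Algebra.adjoin ℤ ({θ} : Set (𝓞 K))) :
    ¬ p ∣ subIndex θ := by
  set S := Subalgebra.toSubmodule (Algebra.adjoin ℤ ({θ} : Set (𝓞 K))) with hS
  have hidx : subIndex θ = Nat.card (𝓞 K ⧸ S) := rfl
  have htors : Module.IsTorsion ℤ (𝓞 K ⧸ S) := by
    intro x
    obtain ⟨x, rfl⟩ := Submodule.Quotient.mk_surjective S x
    have hx : (x : K) ∈ Algebra.adjoin ℚ ({(θ : K)} : Set K) := hgen ▸ Algebra.mem_top
    rw [Algebra.adjoin_singleton_eq_range_aeval] at hx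
    obtain ⟨q, hq⟩ := hx
    have hq' : aeval (θ : K) q = x := hq
    obtain ⟨n, hn, hnq⟩ := IsLocalization.integerNormalization_spec (nonZeroDivisors ℤ) q
    set s := IsLocalization.integerNormalization (nonZeroDivisors ℤ) q
    refine ⟨⟨n, hn⟩, ?_⟩
    have hs : aeval θ s = n • x := by
      apply RingOfIntegers.coe_injective
      have h1 : aeval (θ : K) (s.map (algebraMap ℤ ℚ)) = n • (x : K) := by
        rw [hnq, map_zsmul, hq']
      rw [aeval_map_algebraMap] at h1
      rw [map_zsmul, ← h1]
      exact (aeval_algebraMap_apply K θ s).symm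
    refine (Submodule.Quotient.mk_eq_zero S).2 ?_
    change n • x ∈ S
    rw [← hs]
    exact aeval_mem_adjoin_singleton ℤ θ
  have : Module.Finite ℤ (𝓞 K ⧸ S) := inferInstance
  have : Finite (𝓞 K ⧸ S) := Module.finite_of_fg_torsion _ htors
  rw [hidx]
  intro hdvd
  obtain ⟨x, hx⟩ := exists_prime_addOrderOf_dvd_card' p hdvd
  obtain ⟨x, rfl⟩ := Submodule.Quotient.mk_surjective S x
  have h0 : p • (Submodule.Quotient.mk x : 𝓞 K ⧸ S) = 0 := by
    rw [← hx]; exact addOrderOf_nsmul_eq_zero _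
  have h1 : (p : 𝓞 K) * x ∈ S := by
    rw [← nsmul_eq_mul]
    exact (Submodule.Quotient.mk_eq_zero S).1 (by rw [← h0]; rfl)
  have h2 : (Submodule.Quotient.mk x : 𝓞 K ⧸ S) = 0 :=
    (Submodule.Quotient.mk_eq_zero S).2 (htor x h1)
  rw [h2, addOrderOf_zero] at hx
  exact (Fact.out : p.Prime).one_lt.ne hx

lemma minpoly_eq_and_adjoin_eq_top {K : Type*} [Field K] [NumberField K]
    (hK : (Module.finrank ℚ K).Prime) (θ : 𝓞 K) {g : ℤ[X]} (hg : g.Monic)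
    (hdeg : g.natDegree = Module.finrank ℚ K) (hgθ : aeval θ g = 0)
    (hθ : (θ : K) ∉ Set.range (algebraMap ℚ K)) :
    minpoly ℤ θ = g ∧ Algebra.adjoin ℚ ({(θ : K)} : Set K) = ⊤ := by
  have hint : IsIntegral ℚ (θ : K) := IsIntegral.of_finite ℚ _
  have hd : (minpoly ℚ (θ : K)).natDegree = Module.finrank ℚ K := by
    rcases (Nat.dvd_prime hK).1 (minpoly.degree_dvd hint) with h | h
    · exact absurd (minpoly.mem_range_of_degree_eq_one ℚ (θ : K)
        ((degree_eq_iff_natDegree_eq (minpoly.ne_zero hint)).2 h)) hθ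
    · exact h
  constructor
  · have h1 : minpoly ℚ (θ : K) = (minpoly ℤ θ).map (algebraMap ℤ ℚ) := by
      exact minpoly.isIntegrallyClosed_eq_field_fractions ℚ K (RingOfIntegers.isIntegral θ)
    have hm := minpoly.monic (RingOfIntegers.isIntegral θ)
    refine (eq_of_monic_of_dvd_of_natDegree_le hm hg
      (minpoly.isIntegrallyClosed_dvd (RingOfIntegers.isIntegral θ) hgθ) ?_).symm
    rw [hdeg, ← hd, h1, hm.natDegree_map]
  · exact Algebra.adjoin_eq_top_of_primitive_element hint.isAlgebraic
      ((Field.primitive_element_iff_minpoly_natDegree_eq ℚ _).2 hd)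

/-- Dedekind's criterion in a field of degree five, applied to a root `θ` of an explicit integer
quintic with reduction `X ^ 5 + k₄ X ^ 4 + k₃ X ^ 3 + k₂ X ^ 2 + k₁ X + k₀`. -/
lemma not_isCommonIndexDivisor_of_quintic {K : Type*} [Field K] [NumberField K]
    (hK : Module.finrank ℚ K = 5) {p : ℕ} [Fact p.Prime] (c₀ c₁ c₂ c₃ c₄ : ℤ)
    (k₀ k₁ k₂ k₃ k₄ : ZMod p) (θ : K)
    (hroot : θ ^ 5 + c₄ * θ ^ 4 + c₃ * θ ^ 3 + c₂ * θ ^ 2 + c₁ * θ + c₀ = 0)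
    (hθ : θ ∉ Set.range (algebraMap ℚ K))
    (h₀ : (c₀ : ZMod p) = k₀) (h₁ : (c₁ : ZMod p) = k₁) (h₂ : (c₂ : ZMod p) = k₂)
    (h₃ : (c₃ : ZMod p) = k₃) (h₄ : (c₄ : ZMod p) = k₄)
    (hsq : ∀ π : (ZMod p)[X], Irreducible π →
      π ^ 2 ∣ X ^ 5 + C k₄ * X ^ 4 + C k₃ * X ^ 3 + C k₂ * X ^ 2 + C k₁ * X + C k₀ →
      ∃ r : ℤ, π ∣ X - C (r : ZMod p) ∧
        ¬ (p : ℤ) ^ 2 ∣ r ^ 5 + c₄ * r ^ 4 + c₃ * r ^ 3 + c₂ * r ^ 2 + c₁ * r + c₀) :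
    ¬ IsCommonIndexDivisor p K := by
  subst h₀ h₁ h₂ h₃ h₄
  set g : ℤ[X] := X ^ 5 + C c₄ * X ^ 4 + C c₃ * X ^ 3 + C c₂ * X ^ 2 + C c₁ * X + C c₀ with hg
  have hdeg : g.natDegree = 5 := by rw [hg]; compute_degree!
  have hmonic : g.Monic := by rw [hg]; monicity!
  have hgθ : aeval θ g = 0 := by rw [hg]; simpa using hroot
  obtain ⟨θ, rfl⟩ : ∃ ϑ : 𝓞 K, (ϑ : K) = θ := ⟨⟨θ, g, hmonic, hgθ⟩, rfl⟩
  have hgθ' : aeval θ g = 0 := by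
    apply RingOfIntegers.coe_injective
    rw [map_zero, ← hgθ]
    exact (aeval_algebraMap_apply K θ g).symm
  obtain ⟨hmin, hgen⟩ := minpoly_eq_and_adjoin_eq_top (by rw [hK]; norm_num) θ hmonic
    (hdeg.trans hK.symm) hgθ' hθ
  intro hcid
  refine not_dvd_subIndex θ hgen (fun x hx => mem_adjoin_of_mul_mem_adjoin θ ?_ hx) (hcid θ hgen)
  intro π hπ hdvd
  obtain ⟨r, hr, hr'⟩ := hsq π hπ (by simpa [hmin, hg] using hdvd)
  exact ⟨r, hr, by simpa [hmin, hg] using hr'⟩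

lemma dvd_derivative_of_sq_dvd {R : Type*} [CommRing R] {π f : R[X]} (h : π ^ 2 ∣ f) :
    π ∣ derivative f := by
  obtain ⟨s, rfl⟩ := h
  refine ⟨2 * derivative π * s + π * derivative s, ?_⟩
  rw [derivative_mul, derivative_pow]
  simp only [Nat.cast_ofNat, map_ofNat, Nat.add_one_sub_one, pow_one]
  ring

lemma dvd_derivative_of_sq_dvd_quintic {R : Type*} [CommRing R] {π : R[X]}
    {c₀ c₁ c₂ c₃ c₄ : R}
    (h : π ^ 2 ∣ X ^ 5 + C c₄ * X ^ 4 + C c₃ * X ^ 3 + C c₂ * X ^ 2 + C c₁ * X + C c₀) :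
    π ∣ 5 * X ^ 4 + 4 * C c₄ * X ^ 3 + 3 * C c₃ * X ^ 2 + 2 * C c₂ * X + C c₁ := by
  convert dvd_derivative_of_sq_dvd h using 1
  simp only [derivative_add, derivative_mul, derivative_X_pow, derivative_C, derivative_X,
    Nat.cast_ofNat, map_ofNat, Nat.add_one_sub_one]
  ring

lemma three_eq_zero : (3 : (ZMod 3)[X]) = 0 := by
  exact_mod_cast CharP.cast_eq_zero (ZMod 3)[X] 3

lemma eq_zero_of_sq_dvd_trinomial {π : (ZMod 3)[X]} (hπ : Irreducible π) {a b : ZMod 3}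
    (h : π ^ 2 ∣ X ^ 5 + C 0 * X ^ 4 + C 0 * X ^ 3 + C a * X ^ 2 + C 0 * X + C b) : b = 0 := by
  by_contra hb
  have h2 : π ∣ C b := by
    convert dvd_add ((dvd_pow_self π two_ne_zero).trans h)
      ((dvd_derivative_of_sq_dvd_quintic h).mul_left X) using 1
    simp only [map_zero]
    linear_combination (-2 * X ^ 5 - C a * X ^ 2) * three_eq_zero
  exact hπ.not_isUnit (isUnit_of_dvd_unit h2 (isUnit_C.2 (isUnit_iff_ne_zero.2 hb)))

lemma dvd_X_or_dvd_of_sq_dvd_trinomial {π : (ZMod 3)[X]} (hπ : Irreducible π) {a : ZMod 3}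
    (h : π ^ 2 ∣ X ^ 5 + C 0 * X ^ 4 + C 0 * X ^ 3 + C a * X ^ 2 + C 0 * X + C 0) :
    π ∣ X ∨ π ∣ X + C a := by
  have ha : C a ^ 3 = C a := by rw [← C_pow, ZMod.pow_card]
  have h1 : π ∣ X ^ 2 * (X + C a) ^ 3 := by
    convert (dvd_pow_self π two_ne_zero).trans h using 1
    simp only [map_zero]
    linear_combination X ^ 2 * ha + (X ^ 4 * C a + X ^ 3 * C a ^ 2) * three_eq_zero
  exact (hπ.prime.dvd_or_dvd h1).imp hπ.prime.dvd_of_dvd_pow hπ.prime.dvd_of_dvd_pow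

lemma dvd_X_of_sq_dvd_quintic {π : (ZMod 3)[X]} (hπ : Irreducible π) {s : ZMod 3}
    (h : π ^ 2 ∣ X ^ 5 + C 0 * X ^ 4 + C s * X ^ 3 + C 0 * X ^ 2 + C 0 * X + C 0) :
    π ∣ X := by
  have h1 : π ∣ X ^ 4 := by
    convert (dvd_derivative_of_sq_dvd_quintic h).neg_right using 1
    simp only [map_zero]
    linear_combination (2 * X ^ 4 + C s * X ^ 2) * three_eq_zero
  exact hπ.prime.dvd_of_dvd_pow h1

lemma dvd_X_or_dvd_of_sq_dvd_quintic {π : (ZMod 3)[X]} (hπ : Irreducible π) {u : ZMod 3}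
    (hu : u ^ 2 = 1)
    (h : π ^ 2 ∣ X ^ 5 + C u * X ^ 4 + C (-1) * X ^ 3 + C (-u) * X ^ 2 + C 0 * X + C 0) :
    π ∣ X ∨ π ∣ X + C u := by
  have hu' : C u ^ 2 = 1 := by rw [← C_pow, hu, C_1]
  have h1 : π ∣ X ^ 2 * (X + C u) ^ 2 * (X - C u) := by
    convert (dvd_pow_self π two_ne_zero).trans h using 1
    simp only [map_zero, map_neg, map_one]
    linear_combination (-X ^ 3 - C u * X ^ 2) * hu'
  rcases hπ.prime.dvd_or_dvd h1 with h1 | h1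
  · exact (hπ.prime.dvd_or_dvd h1).imp hπ.prime.dvd_of_dvd_pow hπ.prime.dvd_of_dvd_pow
  · exfalso
    have h2 : π ∣ 1 := by
      convert dvd_sub (dvd_derivative_of_sq_dvd_quintic h)
        (h1.mul_right (-X ^ 3 + C u)) using 1
      simp only [map_zero, map_neg, map_one]
      linear_combination -hu' - (2 * X ^ 4 + C u * X ^ 3 - X ^ 2 - C u * X) * three_eq_zero
    exact hπ.not_isUnit (isUnit_of_dvd_one h2)

/-- An element `α` of degree five satisfies no nontrivial cubic relation. -/
lemma eq_zero_of_cubic {K : Type*} [Field K] [Algebra ℚ K] {α : K}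
    (hα : (minpoly ℚ α).natDegree = 5) {c₀ c₁ c₂ c₃ : ℚ}
    (h : (c₃ : ℚ) • α ^ 3 + c₂ • α ^ 2 + c₁ • α + algebraMap ℚ K c₀ = 0) :
    c₁ = 0 ∧ c₂ = 0 ∧ c₃ = 0 := by
  have h0 : C c₃ * X ^ 3 + C c₂ * X ^ 2 + C c₁ * X + C c₀ = 0 := by
    by_contra hne
    have h1 := natDegree_le_natDegree
      (minpoly.degree_le_of_ne_zero ℚ α hne (by simpa [Algebra.smul_def] using h))
    have h2 : (C c₃ * X ^ 3 + C c₂ * X ^ 2 + C c₁ * X + C c₀).natDegree ≤ 3 := by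
      compute_degree
    omega
  refine ⟨?_, ?_, ?_⟩
  · simpa using congrArg (fun q => coeff q 1) h0
  · simpa using congrArg (fun q => coeff q 2) h0
  · simpa using congrArg (fun q => coeff q 3) h0

lemma natDegree_minpoly_of_trinomial {a b : ℤ}
    (hirr : Irreducible (X ^ 5 + C (a : ℚ) * X ^ 2 + C (b : ℚ)))
    {K : Type*} [Field K] [NumberField K] {α : K}
    (hroot : α ^ 5 + (a : K) * α ^ 2 + (b : K) = 0) :
    (minpoly ℚ α).natDegree = 5 := by
  rw [← minpoly.eq_of_irreducible_of_monic hirr (by simpa using hroot) (by monicity!)]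
  compute_degree!

lemma trinomial_eval_ne_zero {a b : ℤ}
    (hirr : Irreducible (X ^ 5 + C (a : ℚ) * X ^ 2 + C (b : ℚ))) (r : ℤ) :
    r ^ 5 + a * r ^ 2 + b ≠ 0 := by
  intro h
  have hdeg : (X ^ 5 + C (a : ℚ) * X ^ 2 + C (b : ℚ)).natDegree = 5 := by compute_degree!
  have h1 := degree_eq_one_of_irreducible_of_root hirr (x := (r : ℚ)) (by
    simpa using by exact_mod_cast h)
  rw [degree_eq_natDegree hirr.ne_zero, hdeg] at h1
  norm_num at h1

section Trinomial

variable {K : Type*} [Field K] [NumberField K]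

lemma not_isCommonIndexDivisor_of_not_dvd (hK : Module.finrank ℚ K = 5) {a b : ℤ} {α : K}
    (hroot : α ^ 5 + (a : K) * α ^ 2 + (b : K) = 0) (hα : (minpoly ℚ α).natDegree = 5)
    (hb : ¬ 3 ∣ b ∨ 3 ∣ b ∧ ¬ 9 ∣ b ∧ ¬ 9 ∣ (-a) ^ 5 + a * (-a) ^ 2 + b) :
    ¬ IsCommonIndexDivisor 3 K := by
  refine not_isCommonIndexDivisor_of_quintic hK b 0 a 0 0 b 0 a 0 0 α ?_ ?_ rfl
    Int.cast_zero rfl Int.cast_zero Int.cast_zero ?_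
  · push_cast
    linear_combination hroot
  · rintro ⟨q, hq⟩
    exact one_ne_zero (eq_zero_of_cubic hα (c₀ := -q) (c₁ := 1) (c₂ := 0) (c₃ := 0)
      (by rw [map_neg, hq]; simp)).1
  · intro π hπ hdvd
    rcases hb with hb | ⟨hb, hb0, hba⟩
    · exact absurd ((ZMod.intCast_zmod_eq_zero_iff_dvd _ _).1
        (eq_zero_of_sq_dvd_trinomial hπ hdvd)) hb
    · rw [(ZMod.intCast_zmod_eq_zero_iff_dvd b 3).2 hb] at hdvd
      rcases dvd_X_or_dvd_of_sq_dvd_trinomial hπ hdvd with h | h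
      · exact ⟨0, by simpa using h, by simpa using hb0⟩
      · refine ⟨-a, by simpa using h, ?_⟩
        convert hba using 1
        push_cast
        ring_nf

lemma cast_sq_eq_one {a : ℤ} (ha : a ≡ 4 [ZMOD 9] ∨ a ≡ -4 [ZMOD 9]) : (a : ZMod 3) ^ 2 = 1 := by
  have h : (a : ZMod 3) = 1 ∨ (a : ZMod 3) = -1 := by
    rcases ha with ha | ha
    · left
      exact_mod_cast (ZMod.intCast_eq_intCast_iff a 1 3).2 ((ha.of_dvd (by norm_num)).trans
        (by decide))
    · right
      exact_mod_cast (ZMod.intCast_eq_intCast_iff a (-1) 3).2 ((ha.of_dvd (by norm_num)).trans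
        (by decide))
  rcases h with h | h <;> rw [h] <;> rfl

lemma cast_nine {a : ℤ} (ha : a ≡ 4 [ZMOD 9] ∨ a ≡ -4 [ZMOD 9]) :
    (a : ZMod 9) = 4 ∨ (a : ZMod 9) = -4 :=
  ha.imp (fun h => by exact_mod_cast (ZMod.intCast_eq_intCast_iff a 4 9).2 h)
    (fun h => by exact_mod_cast (ZMod.intCast_eq_intCast_iff a (-4) 9).2 h)

lemma exists_cast_eq_three_mul {t : ℤ} (ht : 3 ∣ t) :
    ∃ s : ZMod 9, (t : ZMod 9) = 3 * s := by
  obtain ⟨s, rfl⟩ := ht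
  exact ⟨s, by push_cast; rfl⟩

lemma not_nine_dvd_iff (n : ℤ) : ¬ (((3 : ℕ) : ℤ) ^ 2 ∣ n) ↔ (n : ZMod 9) ≠ 0 := by
  rw [Ne, ZMod.intCast_zmod_eq_zero_iff_dvd]
  norm_num

/-- The case `b = t ^ 2 * c` with `3 ∣ t` and `3` exactly dividing `c`. The generator used is
`α - t * c / α`. -/
lemma not_isCommonIndexDivisor_of_three_dvd (hK : Module.finrank ℚ K = 5) {a c t : ℤ}
    (ha : a ≡ 4 [ZMOD 9] ∨ a ≡ -4 [ZMOD 9]) {α : K}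
    (hroot : α ^ 5 + (a : K) * α ^ 2 + ((t ^ 2 * c : ℤ) : K) = 0)
    (hα : (minpoly ℚ α).natDegree = 5) (hα0 : α ≠ 0)
    (ht : 3 ∣ t) (hc : 3 ∣ c) (hc' : ¬ 9 ∣ c) :
    ¬ IsCommonIndexDivisor 3 K := by
  have ht3 : (t : ZMod 3) = 0 := (ZMod.intCast_zmod_eq_zero_iff_dvd t 3).2 ht
  have hc3 : (c : ZMod 3) = 0 := (ZMod.intCast_zmod_eq_zero_iff_dvd c 3).2 hc
  obtain ⟨s, hs⟩ := exists_cast_eq_three_mul ht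
  obtain ⟨r, hr⟩ := exists_cast_eq_three_mul hc
  have hr0 : 3 * r ≠ 0 := by
    rw [← hr, Ne, ZMod.intCast_zmod_eq_zero_iff_dvd]
    exact hc'
  push_cast at hroot
  refine not_isCommonIndexDivisor_of_quintic hK
    (-c ^ 4 * t ^ 3 + c * t ^ 2 + a ^ 2 * c + 2 * a * c * t) (5 * c ^ 2 * t ^ 2 + 3 * a * c ^ 2 * t)
    a (5 * c * t + a * c) 0 0 0 a 0 0 ((α ^ 2 - t * c) / α) ?_ ?_ (by simp [hc3]) (by simp [hc3])
    rfl (by simp [hc3]) Int.cast_zero ?_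
  · push_cast
    field_simp
    linear_combination (-(c : K) ^ 4 * t ^ 3 + a * c * α ^ 3 + α ^ 5) * hroot
  · rintro ⟨q, hq⟩
    rw [eq_div_iff hα0] at hq
    exact one_ne_zero (eq_zero_of_cubic hα (c₀ := -(t * c)) (c₁ := -q) (c₂ := 1) (c₃ := 0)
      (by simp [Algebra.smul_def] at hq ⊢; linear_combination -hq)).2.1
  · intro π hπ hdvd
    rcases dvd_X_or_dvd_of_sq_dvd_trinomial hπ hdvd with h | h
    · refine ⟨0, by simpa using h, (not_nine_dvd_iff _).2 ?_⟩
      push_cast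
      rw [hs, hr]
      rcases cast_nine ha with h4 | h4 <;> rw [h4] <;> clear hs hr hc' <;> revert s r <;>
        decide +kernel
    · refine ⟨-a, by simpa using h, (not_nine_dvd_iff _).2 ?_⟩
      push_cast
      rw [hs, hr]
      rcases cast_nine ha with h4 | h4 <;> rw [h4] <;> clear hs hr hc' <;> revert s r <;>
        decide +kernel

/-- The case `b = t ^ 2 * c` with `3 ∣ t` and `¬ 3 ∣ c`. The generator used is
`α ^ 2 + a * α - t * c / α`. -/
lemma not_isCommonIndexDivisor_of_not_three_dvd (hK : Module.finrank ℚ K = 5) {a c t : ℤ}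
    (ha : a ≡ 4 [ZMOD 9] ∨ a ≡ -4 [ZMOD 9]) {α : K}
    (hroot : α ^ 5 + (a : K) * α ^ 2 + ((t ^ 2 * c : ℤ) : K) = 0)
    (hα : (minpoly ℚ α).natDegree = 5) (hα0 : α ≠ 0)
    (ht : 3 ∣ t) (hc : ¬ 3 ∣ c) :
    ¬ IsCommonIndexDivisor 3 K := by
  have ht3 : (t : ZMod 3) = 0 := (ZMod.intCast_zmod_eq_zero_iff_dvd t 3).2 ht
  have ha3 := cast_sq_eq_one ha
  have h3 : (3 : ZMod 3) = 0 := rfl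
  obtain ⟨s, hs⟩ := exists_cast_eq_three_mul ht
  have hc9 : 3 * (c : ZMod 9) ≠ 0 := by
    intro h
    have h1 : ((3 * c : ℤ) : ZMod 9) = 0 := by push_cast; exact h
    rw [ZMod.intCast_zmod_eq_zero_iff_dvd] at h1
    push_cast at h1
    omega
  push_cast at hroot
  refine not_isCommonIndexDivisor_of_quintic hK
    (-c^4*t^3 - c^2*t^4 + a^5*c*t^2 + 2*a^5*c*t + a^5*c - a^3*c*t^2 - 2*a^3*c*t - a^3*c
      - 5*a^2*c^2*t^3 - 7*a^2*c^2*t^2 - 3*a^2*c^2*t - 5*a*c^3*t^3 - 3*a*c^3*t^2)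
    (-5*c^2*t^3 + 5*a^3*c*t^2 + 6*a^3*c*t + 3*a^3*c + 5*a^2*c^2*t^2 + 3*a^2*c^2*t - 2*a*c*t^2)
    (-5*c^2*t^2 + a^4 - a^2 + 5*a*c*t^2 - 3*a*c*t) (3*a^2 + 5*a*c*t + a*c) 0
    0 0 0 (a * c) 0 ((α ^ 3 + a * α ^ 2 - t * c) / α) ?_ ?_
    (by push_cast; rw [ht3]; linear_combination (a ^ 3 * c : ZMod 3) * ha3)
    (by push_cast; rw [ht3]; linear_combination (a ^ 3 * c : ZMod 3) * h3)
    (by push_cast; rw [ht3]; linear_combination (a ^ 2 : ZMod 3) * ha3)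
    (by push_cast; rw [ht3]; linear_combination (a ^ 2 : ZMod 3) * h3) Int.cast_zero ?_
  · push_cast
    field_simp
    linear_combination (-(c:K)^4*t^3 - 3*a^2*c^2*t*α^2
      + (a^4*c - a^2*c + 5*a*c^2*t^2 - 3*a*c^2*t)*α^3
      + (5*c^2*t^2 - 5*a^3*c*t + 3*a^3*c + 2*a*c*t)*α^4
      + (-c*t^2 + a^5 - a^3 - 15*a^2*c*t + 3*a^2*c)*α^5
      + (5*a^4 - 2*a^2 - 15*a*c*t + a*c)*α^6 + (-5*c*t + 10*a^3 - a)*α^7 + 10*a^2*α^8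
      + 5*a*α^9 + α^10) * hroot
  · rintro ⟨q, hq⟩
    rw [eq_div_iff hα0] at hq
    exact one_ne_zero (eq_zero_of_cubic hα (c₀ := -(t * c)) (c₁ := -q) (c₂ := a) (c₃ := 1)
      (by simp [Algebra.smul_def] at hq ⊢; linear_combination -hq)).2.2
  · intro π hπ hdvd
    refine ⟨0, by simpa using dvd_X_of_sq_dvd_quintic hπ hdvd, (not_nine_dvd_iff _).2 ?_⟩
    push_cast
    rw [hs]
    generalize (c : ZMod 9) = c' at *
    clear hs
    rcases cast_nine ha with h4 | h4 <;> rw [h4] <;> revert s c' <;> decide +kernel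

set_option maxHeartbeats 1000000 in
/-- The case where `-a = u` is a root of the trinomial modulo `9`. The generator used is
`y + 9 * u * d ^ 2 / y ^ 2`, where `y = α - u`. -/
lemma not_isCommonIndexDivisor_of_neg_root_mod_nine (hK : Module.finrank ℚ K = 5) {u d : ℤ}
    (hu : u ≡ 4 [ZMOD 9] ∨ u ≡ -4 [ZMOD 9]) {α : K}
    (hroot : α ^ 5 + (-u : K) * α ^ 2 + ((9 * d - u ^ 5 + u ^ 3 : ℤ) : K) = 0)
    (hα : (minpoly ℚ α).natDegree = 5) :
    ¬ IsCommonIndexDivisor 3 K := by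
  have hy0 : α - u ≠ 0 := by
    intro h
    exact one_ne_zero (eq_zero_of_cubic hα (c₀ := -u) (c₁ := 1) (c₂ := 0) (c₃ := 0)
      (by simpa [sub_eq_add_neg] using h)).1
  obtain ⟨y, hy⟩ : ∃ y, y = α - u := ⟨_, rfl⟩
  rw [← hy] at hy0
  have hu2 : ∃ k, u ^ 2 = 7 + 9 * k := by
    rcases hu with h | h <;> obtain ⟨k, hk⟩ := h.symm.dvd <;> rw [sub_eq_iff_eq_add] at hk <;>
      rw [hk]
    · exact ⟨9 * k ^ 2 + 8 * k + 1, by ring⟩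
    · exact ⟨9 * k ^ 2 - 8 * k + 1, by ring⟩
  obtain ⟨k, hk⟩ := hu2
  obtain ⟨e, he'⟩ : ∃ e, e = 77 + 204 * k + 135 * k ^ 2 := ⟨_, rfl⟩
  obtain ⟨f, hf'⟩ : ∃ f, f = u * (23 + 30 * k) := ⟨_, rfl⟩
  have he : 3 * e = 5 * u ^ 4 - 2 * u ^ 2 := by
    rw [he']; linear_combination (-5 * u ^ 2 - 45 * k - 33) * hk
  have hf : 3 * f = 10 * u ^ 3 - u := by
    rw [hf']; linear_combination -10 * u * hk
  have heK : 3 * (e : K) = 5 * u ^ 4 - 2 * u ^ 2 := by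
    exact_mod_cast congrArg (Int.cast (R := K)) he
  have hfK : 3 * (f : K) = 10 * u ^ 3 - u := by
    exact_mod_cast congrArg (Int.cast (R := K)) hf
  have hG : y ^ 5 + 5 * u * y ^ 4 + 10 * u ^ 2 * y ^ 3 + 3 * f * y ^ 2 + 3 * e * y + 9 * d = 0 := by
    rw [heK, hfK, hy]
    push_cast at hroot
    linear_combination hroot
  have hu3 := cast_sq_eq_one hu
  have h3 : (3 : ZMod 3) = 0 := rfl
  have he3 : (e : ZMod 3) = -1 := by
    rw [he']; push_cast; linear_combination (26 + 68 * (k : ZMod 3) + 45 * k ^ 2) * h3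
  refine not_isCommonIndexDivisor_of_quintic hK
    (-3*e^3*u - 729*d^8*u^5 - 2025*d^6*u^7 + 729*d^6*f*u^4 + 1215*d^5*u^4 - 9000*d^4*u^9 -
      243*d^4*f^2*u^3 + 4050*d^4*f*u^6 - 1215*d^4*e*u^5 + 2700*d^3*u^6 - 405*d^3*f*u^3 -
      81*d^3*e*u^2 - 270*d^2*u^3 + 27*d^2*f^3*u^2 + 135*d^2*e^2*u^3 - 270*d^2*e*f*u^4 + 27*d*e*f*u +
      9*d)
    (-3*e^2*f*u + 3*e + 405*d^6*u^6 + 405*d^5*u^3 - 4500*d^4*u^8 + 1620*d^4*f*u^5 - 675*d^4*e*u^4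
      + 2250*d^3*u^5 - 189*d^3*f*u^2 - 180*d^2*u^2 + 90*d^2*f^2*u^4 + 36*d^2*e^2*u^2 - 600*d^2*e*u^6
      - 45*d^2*e*f*u^3 + 18*d*f^2*u + 30*d*e*u^3)
    (3*f - 10*e^2*u^3 - 900*d^4*u^7 + 270*d^4*f*u^4 - 54*d^4*e*u^3 + 720*d^3*u^4 - 45*d^2*u +
      45*d^2*f^2*u^3 - 300*d^2*e*u^5 - 9*d^2*e*f*u^2 + 60*d*f*u^3 + 15*d*e*u^2)
    (10*u^2 - 5*e^2*u^2 + 90*d^3*u^3 + 9*d^2*f^2*u^2 - 60*d^2*e*u^4 + 30*d*f*u^2 + 3*d*e*u)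
    (5*u - e^2*u + 6*d*f*u)
    0 0 (-u) (-1) u ((y ^ 3 + 9 * u * d ^ 2) / y ^ 2) ?_ ?_ ?_ ?_ ?_ ?_ ?_ ?_
  · push_cast
    field_simp
    linear_combination ((6561*d^9*u^5) + (-2187*d^8*e*u^5)*y + (2187*d^8*f*u^5 +
      3645*d^7*u^5)*y^2 + (-7290*d^8*u^7 + 3645*d^7*u^4 - 1215*d^6*e*u^5)*y^3 + (3645*d^8*u^6 +
      1215*d^6*f*u^5 - 972*d^6*e*u^4 + 810*d^5*u^5)*y^4 + (-729*d^8*u^5 - 4050*d^6*u^7 +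
      729*d^6*f*u^4 + 1620*d^5*u^4 - 270*d^4*e*u^5)*y^5 + (405*d^6*u^6 + 405*d^5*u^3 +
      270*d^4*f*u^5 - 405*d^4*e*u^4 + 27*d^3*f*u^2)*y^6 + (-900*d^4*u^7 + 270*d^4*f*u^4 -
      54*d^4*e*u^3 + 270*d^3*u^4 - 9*d^2*e*f*u^2)*y^7 + (90*d^3*u^3 + 9*d^2*f^2*u^2 - 60*d^2*e*u^4
      + 3*d*e*u)*y^8 + (-e^2*u + 6*d*f*u)*y^9 + y^10 : K) * hG
  · rintro ⟨q, hq⟩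
    rw [eq_div_iff (pow_ne_zero 2 hy0), hy] at hq
    exact one_ne_zero (eq_zero_of_cubic hα (c₀ := -u ^ 3 + 9 * u * d ^ 2 - q * u ^ 2)
      (c₁ := 3 * u ^ 2 + 2 * q * u) (c₂ := -3 * u - q) (c₃ := 1)
      (by simp [Algebra.smul_def] at hq ⊢; linear_combination -hq)).2.2
  iterate 5
    · push_cast
      rw [he3]
      generalize (u : ZMod 3) = u' at hu3 ⊢
      generalize (f : ZMod 3) = f'
      generalize (d : ZMod 3) = d'
      clear h3 he3
      revert u' f' d'
      decide +kernel
  · intro π hπ hdvd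
    rcases dvd_X_or_dvd_of_sq_dvd_quintic hπ hu3 hdvd with h | h
    · refine ⟨0, by simpa using h, (not_nine_dvd_iff _).2 ?_⟩
      rw [he', hf']
      push_cast
      generalize (k : ZMod 9) = k'
      generalize (d : ZMod 9) = d'
      rcases cast_nine hu with h4 | h4 <;> rw [h4] <;> revert k' d' <;> decide +kernel
    · refine ⟨-u, by simpa using h, (not_nine_dvd_iff _).2 ?_⟩
      rw [he', hf']
      push_cast
      generalize (k : ZMod 9) = k'
      generalize (d : ZMod 9) = d'
      rcases cast_nine hu with h4 | h4 <;> rw [h4] <;> revert k' d' <;> decide +kernel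

end Trinomial

lemma exists_eq_sq_mul_of_nine_dvd {b : ℤ} (hb0 : b ≠ 0) (hb : 9 ∣ b) :
    ∃ t c : ℤ, b = t ^ 2 * c ∧ 3 ∣ t ∧ ¬ 9 ∣ c := by
  obtain ⟨c, hc, hc'⟩ := (Int.finiteMultiplicity_iff (a := 9).2
    ⟨by norm_num, hb0⟩).exists_eq_pow_mul_and_not_dvd
  refine ⟨3 ^ multiplicity 9 b, c, ?_, dvd_pow_self 3 ?_, hc'⟩
  · rw [← pow_mul, mul_comm _ 2, pow_mul]
    exact hc
  · intro h
    rw [h, pow_zero, one_mul] at hc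
    exact hc' (hc ▸ hb)

theorem stmt_16 (a b : ℤ)
    (hirr : Irreducible (X ^ 5 + C (a : ℚ) * X ^ 2 + C (b : ℚ)))
    (ha : a ≡ 4 [ZMOD 9] ∨ a ≡ -4 [ZMOD 9]) (ha3 : ¬ (3 : ℤ) ∣ a)
    (K : Type*) [Field K] [NumberField K] (α : K)
    (hroot : α ^ 5 + (a : K) * α ^ 2 + (b : K) = 0)
    (hgen : Algebra.adjoin ℚ ({α} : Set K) = ⊤) :
    ¬ IsCommonIndexDivisor 3 K := by
  have hα := natDegree_minpoly_of_trinomial hirr hroot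
  have hK : Module.finrank ℚ K = 5 := by
    rw [← hα, eq_comm, ← Field.primitive_element_iff_minpoly_natDegree_eq, eq_top_iff]
    intro x _
    exact IntermediateField.algebra_adjoin_le_adjoin ℚ {α} (hgen ▸ Algebra.mem_top)
  by_cases hb3 : 3 ∣ b
  swap
  · exact not_isCommonIndexDivisor_of_not_dvd hK hroot hα (.inl hb3)
  have hb0 : b ≠ 0 := by simpa using trinomial_eval_ne_zero hirr 0
  by_cases hb9 : 9 ∣ b
  · obtain ⟨t, c, rfl, ht, hc⟩ := exists_eq_sq_mul_of_nine_dvd hb0 hb9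
    have hα0 : α ≠ 0 := by
      rintro rfl
      have h : ((t ^ 2 * c : ℤ) : K) = 0 := by simpa using hroot
      exact hb0 (by exact_mod_cast h)
    by_cases hc3 : 3 ∣ c
    · exact not_isCommonIndexDivisor_of_three_dvd hK ha hroot hα hα0 ht hc3 hc
    · exact not_isCommonIndexDivisor_of_not_three_dvd hK ha hroot hα hα0 ht hc3
  by_cases hba : 9 ∣ (-a) ^ 5 + a * (-a) ^ 2 + b
  swap
  · exact not_isCommonIndexDivisor_of_not_dvd hK hroot hα (.inr ⟨hb3, hb9, hba⟩)
  obtain ⟨d, hd⟩ := hba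
  obtain ⟨u, rfl⟩ : ∃ u, a = -u := ⟨-a, by ring⟩
  obtain rfl : b = 9 * d - u ^ 5 + u ^ 3 := by linear_combination hd
  have hu : u ≡ 4 [ZMOD 9] ∨ u ≡ -4 [ZMOD 9] :=
    ha.symm.imp (fun h => by simpa using h.neg) (fun h => by simpa using h.neg)
  exact not_isCommonIndexDivisor_of_neg_root_mod_nine hK hu (by exact_mod_cast hroot) hα
end

section
/- Let F(x) = x^5 + 3x^2 + 48u where u is an odd integer not divisible by 3 and F is irreducible over ℚ, and let K be the number field it defines. Then 2 is a common index divisor of K if and only if u ≡ 3 (mod 4). -/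
open Polynomial NumberField

theorem exists_two_pow_pow_eq_two_mul {K : Type*} [Field K] (A : Subring K) {x : K}
    (hx : IsIntegral ℤ x) (h : 2 * x ∈ A) : ∃ j : ℕ, ∃ b ∈ A, (2 * x) ^ 2 ^ j = 2 * b := by
  obtain ⟨p, hp, hpx⟩ := hx
  rw [← aeval_def] at hpx
  set d := p.natDegree with hd
  have bounded (N : ℕ) : 2 ^ d * x ^ N ∈ A := by
    have hN : x ^ N = aeval x (X ^ N %ₘ p) := by
      rw [aeval_modByMonic_eq_self_of_root hpx]; simp
    rw [hN, aeval_eq_sum_range' (n := d + 1)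
      (Nat.lt_succ_of_le (natDegree_modByMonic_le _ hp)), Finset.mul_sum]
    refine sum_mem fun i hi => ?_
    have hi' : i ≤ d := Nat.lt_succ_iff.mp (Finset.mem_range.mp hi)
    have : 2 ^ d * ((X ^ N %ₘ p).coeff i • x ^ i)
        = (X ^ N %ₘ p).coeff i • (((2 : ℤ) ^ (d - i)) • (2 * x) ^ i) := by
      rw [← Nat.sub_add_cancel hi', zsmul_eq_mul, zsmul_eq_mul, zsmul_eq_mul, pow_add, mul_pow]
      push_cast [Nat.add_sub_cancel]
      ring
    rw [this]
    exact zsmul_mem (zsmul_mem (pow_mem h i) _) _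
  have hlt : d + 1 ≤ 2 ^ (d + 1) := Nat.lt_two_pow_self.le
  refine ⟨d + 1, ((2 : ℤ) ^ (2 ^ (d + 1) - (d + 1))) • (2 ^ d * x ^ 2 ^ (d + 1)),
    zsmul_mem (bounded _) _, ?_⟩
  rw [mul_pow, zsmul_eq_mul]
  nth_rewrite 1 [← Nat.sub_add_cancel hlt]
  push_cast
  ring

theorem two_mul_mem_of_sq_mem {K : Type*} [Field K] (A : Subring K) (T : Set K)
    (two_mul_mem : ∀ a ∈ A, 2 * a ∈ T) (of_sq_mem : ∀ a ∈ A, a ^ 2 ∈ T → a ∈ T) {x : K}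
    (hx : IsIntegral ℤ x) (h : 2 * x ∈ A) : 2 * x ∈ T := by
  obtain ⟨j, b, hb, hj⟩ := exists_two_pow_pow_eq_two_mul A hx h
  have key : ∀ j : ℕ, (2 * x) ^ 2 ^ j ∈ T → 2 * x ∈ T := by
    intro j
    induction j with
    | zero => simp
    | succ j ih => exact fun hj => ih (of_sq_mem _ (pow_mem h _) (by rwa [← pow_mul, ← pow_succ]))
  exact key j (hj ▸ two_mul_mem b hb)

theorem coeffs_eq_zero_of_natDegree_minpoly {K : Type*} [Field K] [CharZero K] {θ : K}
    (hθ : (minpoly ℚ θ).natDegree = 5) {q₀ q₁ q₂ q₃ q₄ : ℚ}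
    (h : (q₀ : K) + q₁ * θ + q₂ * θ ^ 2 + q₃ * θ ^ 3 + q₄ * θ ^ 4 = 0) :
    q₀ = 0 ∧ q₁ = 0 ∧ q₂ = 0 ∧ q₃ = 0 ∧ q₄ = 0 := by
  set p : ℚ[X] := C q₀ + C q₁ * X + C q₂ * X ^ 2 + C q₃ * X ^ 3 + C q₄ * X ^ 4 with hp
  have hdeg : p.natDegree ≤ 4 := by rw [hp]; compute_degree
  have hp0 : p = 0 := by
    by_contra hne
    have := natDegree_le_of_dvd (minpoly.dvd ℚ θ (p := p) (by simpa [hp] using h)) hne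
    omega
  have hc (i : ℕ) : p.coeff i = 0 := by simp [hp0]
  refine ⟨?_, ?_, ?_, ?_, ?_⟩
  · simpa [hp, coeff_X, coeff_X_pow, coeff_C] using hc 0
  · simpa [hp, coeff_X, coeff_X_pow, coeff_C] using hc 1
  · simpa [hp, coeff_X, coeff_X_pow, coeff_C] using hc 2
  · simpa [hp, coeff_X, coeff_X_pow, coeff_C] using hc 3
  · simpa [hp, coeff_X, coeff_X_pow, coeff_C] using hc 4

theorem adjoin_eq_top_iff_natDegree_minpoly {K : Type*} [Field K] [NumberField K] (θ : K) :
    Algebra.adjoin ℚ {θ} = ⊤ ↔ (minpoly ℚ θ).natDegree = Module.finrank ℚ K := by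
  rw [← Field.primitive_element_iff_minpoly_natDegree_eq,
    IntermediateField.adjoin_simple_eq_top_iff_of_isAlgebraic (Algebra.IsAlgebraic.isAlgebraic θ)]

theorem exists_int_mul_eq_aeval {K : Type*} [Field K] [CharZero K] {θ : K}
    (hθ : Algebra.adjoin ℚ {θ} = ⊤) (x : K) :
    ∃ m : ℤ, m ≠ 0 ∧ ∃ p : ℤ[X], m * x = aeval θ p := by
  have hx : x ∈ Algebra.adjoin ℚ {θ} := hθ ▸ Algebra.mem_top
  rw [Algebra.adjoin_singleton_eq_range_aeval] at hx
  obtain ⟨q, rfl⟩ := hx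
  obtain ⟨b, hb, hbq⟩ := IsLocalization.integerNormalization_spec (nonZeroDivisors ℤ) q
  refine ⟨b, nonZeroDivisors.ne_zero hb,
    IsLocalization.integerNormalization (nonZeroDivisors ℤ) q, ?_⟩
  rw [← aeval_map_algebraMap ℚ, hbq]
  simp

theorem exists_coeffs_of_mem_adjoin {K : Type*} [Field K] [NumberField K]
    (hK : Module.finrank ℚ K = 5) {θ x : 𝓞 K} (hx : x ∈ Algebra.adjoin ℤ {θ}) :
    ∃ c₀ c₁ c₂ c₃ c₄ : ℤ, x = c₀ + c₁ * θ + c₂ * θ ^ 2 + c₃ * θ ^ 3 + c₄ * θ ^ 4 := by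
  rw [Algebra.adjoin_singleton_eq_range_aeval] at hx
  obtain ⟨p, rfl⟩ := hx
  have hθ := Algebra.IsIntegral.isIntegral (R := ℤ) θ
  have hm := minpoly.monic hθ
  have hd : (minpoly ℤ θ).natDegree ≤ 5 := by
    rw [← hK, ← RingOfIntegers.rank]
    exact minpoly.natDegree_le (A := ℤ) θ
  have hlt : (p %ₘ minpoly ℤ θ).natDegree < 5 :=
    (natDegree_modByMonic_lt _ hm (minpoly.ne_one ℤ θ)).trans_le hd
  set q := p %ₘ minpoly ℤ θ with hq
  refine ⟨q.coeff 0, q.coeff 1, q.coeff 2, q.coeff 3, q.coeff 4, ?_⟩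
  have : aeval θ p = aeval θ q := (aeval_modByMonic_eq_self_of_root (minpoly.aeval ℤ θ)).symm
  simp only [AlgHom.toRingHom_eq_coe, RingHom.coe_coe, this]
  rw [aeval_eq_sum_range' hlt]
  simp [Finset.sum_range_succ]

theorem odd_subIndex_of_two_mul {K : Type*} [Field K] [NumberField K] {θ : 𝓞 K}
    (hθ : Algebra.adjoin ℚ {(θ : K)} = ⊤)
    (h : ∀ x : 𝓞 K, 2 * x ∈ Algebra.adjoin ℤ {θ} → x ∈ Algebra.adjoin ℤ {θ}) :
    ¬ 2 ∣ subIndex θ := by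
  set S : AddSubgroup (𝓞 K) := (Algebra.adjoin ℤ {θ}).toSubring.toAddSubgroup with hS
  have hmem (x : 𝓞 K) : x ∈ S ↔ x ∈ Algebra.adjoin ℤ {θ} := Iff.rfl
  have : AddGroup.FG (𝓞 K ⧸ S) := by
    have : AddGroup.FG (𝓞 K) := Module.Finite.iff_addGroup_fg.mp inferInstance
    exact QuotientAddGroup.fg S
  have : Finite (𝓞 K ⧸ S) := by
    have : Module.Finite ℤ (𝓞 K ⧸ S) := Module.Finite.iff_addGroup_fg.mpr inferInstance
    refine Module.finite_of_fg_torsion _ fun y => ?_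
    induction y using QuotientAddGroup.induction_on with
    | H x =>
      obtain ⟨m, hm, p, hp⟩ := exists_int_mul_eq_aeval hθ (x : K)
      refine ⟨⟨m, mem_nonZeroDivisors_of_ne_zero hm⟩, ?_⟩
      rw [Submonoid.smul_def, ← QuotientAddGroup.mk_zsmul, QuotientAddGroup.eq_zero_iff, hmem]
      have : m • x = aeval θ p := by
        apply RingOfIntegers.coe_injective
        rw [zsmul_eq_mul, map_mul, map_intCast, hp]
        exact aeval_algebraMap_apply K θ p
      simp only [this]
      exact aeval_mem_adjoin_singleton _ _
  intro hdvd
  obtain ⟨y, hy⟩ := exists_prime_addOrderOf_dvd_card' (G := 𝓞 K ⧸ S) 2 hdvd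
  induction y using QuotientAddGroup.induction_on with
  | H x =>
    have h2 : 2 • (x : 𝓞 K ⧸ S) = 0 := by rw [← hy]; exact addOrderOf_nsmul_eq_zero _
    rw [← QuotientAddGroup.mk_nsmul, QuotientAddGroup.eq_zero_iff, hmem, nsmul_eq_mul] at h2
    have h0 : (x : 𝓞 K ⧸ S) = 0 := (QuotientAddGroup.eq_zero_iff x).mpr (h x (by exact_mod_cast h2))
    rw [h0, addOrderOf_zero] at hy
    omega

theorem subIndex_mul_mem {K : Type*} [Field K] [NumberField K] (θ x : 𝓞 K) :
    (subIndex θ : 𝓞 K) * x ∈ Algebra.adjoin ℤ {θ} := by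
  rw [← nsmul_eq_mul]
  exact AddSubgroup.nsmul_index_mem (H := (Algebra.adjoin ℤ {θ}).toSubring.toAddSubgroup) x

/-- Integral combinations of `1, α, α ^ 2, α ^ 3, δ`. -/
def lin {K : Type*} [Field K] (α δ : K) (a₀ a₁ a₂ a₃ a₄ : ℤ) : K :=
  a₀ + a₁ * α + a₂ * α ^ 2 + a₃ * α ^ 3 + a₄ * δ

/-- The additive group generated by `1, α, α ^ 2, α ^ 3, δ`. -/
def linSubgroup {K : Type*} [Field K] (α δ : K) : AddSubgroup K where
  carrier := {x | ∃ a₀ a₁ a₂ a₃ a₄ : ℤ, x = lin α δ a₀ a₁ a₂ a₃ a₄}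
  zero_mem' := ⟨0, 0, 0, 0, 0, by simp [lin]⟩
  add_mem' := by
    rintro _ _ ⟨a₀, a₁, a₂, a₃, a₄, rfl⟩ ⟨b₀, b₁, b₂, b₃, b₄, rfl⟩
    exact ⟨a₀ + b₀, a₁ + b₁, a₂ + b₂, a₃ + b₃, a₄ + b₄, by simp only [lin]; push_cast; ring⟩
  neg_mem' := by
    rintro _ ⟨a₀, a₁, a₂, a₃, a₄, rfl⟩
    exact ⟨-a₀, -a₁, -a₂, -a₃, -a₄, by simp only [lin]; push_cast; ring⟩

section lin

variable {K : Type*} [Field K] {α δ : K}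

theorem mul_mem_linSubgroup (h₄ : α ^ 4 ∈ linSubgroup α δ) (hαδ : α * δ ∈ linSubgroup α δ)
    (hδ : δ ^ 2 ∈ linSubgroup α δ) {x y : K} (hx : x ∈ linSubgroup α δ)
    (hy : y ∈ linSubgroup α δ) : x * y ∈ linSubgroup α δ := by
  have intMul {z : K} (n : ℤ) (hz : z ∈ linSubgroup α δ) : n * z ∈ linSubgroup α δ := by
    rw [← zsmul_eq_mul]; exact zsmul_mem hz n
  have mulα {z : K} (hz : z ∈ linSubgroup α δ) : α * z ∈ linSubgroup α δ := by
    obtain ⟨a₀, a₁, a₂, a₃, a₄, rfl⟩ := hz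
    have h : α * lin α δ a₀ a₁ a₂ a₃ a₄
        = lin α δ 0 a₀ a₁ a₂ 0 + a₃ * α ^ 4 + a₄ * (α * δ) := by
      simp only [lin]; push_cast; ring
    rw [h]
    exact add_mem (add_mem ⟨_, _, _, _, _, rfl⟩ (intMul _ h₄)) (intMul _ hαδ)
  have mulδ : δ * y ∈ linSubgroup α δ := by
    obtain ⟨a₀, a₁, a₂, a₃, a₄, rfl⟩ := hy
    have h : δ * lin α δ a₀ a₁ a₂ a₃ a₄
        = lin α δ 0 0 0 0 a₀ + a₁ * (α * δ) + a₂ * (α * (α * δ)) + a₃ * (α * (α * (α * δ)))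
          + a₄ * δ ^ 2 := by
      simp only [lin]; push_cast; ring
    rw [h]
    exact add_mem (add_mem (add_mem (add_mem ⟨_, _, _, _, _, rfl⟩ (intMul _ hαδ))
      (intMul _ (mulα hαδ))) (intMul _ (mulα (mulα hαδ)))) (intMul _ hδ)
  obtain ⟨a₀, a₁, a₂, a₃, a₄, rfl⟩ := hx
  have h : lin α δ a₀ a₁ a₂ a₃ a₄ * y
      = a₀ * y + a₁ * (α * y) + a₂ * (α * (α * y)) + a₃ * (α * (α * (α * y))) + a₄ * (δ * y) := by
    simp only [lin]; ring
  rw [h]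
  exact add_mem (add_mem (add_mem (add_mem (intMul _ hy) (intMul _ (mulα hy)))
    (intMul _ (mulα (mulα hy)))) (intMul _ (mulα (mulα (mulα hy))))) (intMul _ mulδ)

/-- `linSubgroup α δ` as a ring, given the products of generators that have to lie in it. -/
def linSubring (α δ : K) (h₄ : α ^ 4 ∈ linSubgroup α δ) (hαδ : α * δ ∈ linSubgroup α δ)
    (hδ : δ ^ 2 ∈ linSubgroup α δ) : Subring K where
  __ := linSubgroup α δ
  one_mem' := ⟨1, 0, 0, 0, 0, by simp [lin]⟩
  mul_mem' := mul_mem_linSubgroup h₄ hαδ hδ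

theorem lin_sq (A : Subring K) (hA : ∀ x, x ∈ A ↔ x ∈ linSubgroup α δ) (a₀ a₁ a₂ a₃ a₄ : ℤ) :
    ∃ t₀ t₁ t₂ t₃ t₄ : ℤ, lin α δ a₀ a₁ a₂ a₃ a₄ ^ 2 =
      a₀ + a₁ * α ^ 2 + a₂ * α ^ 4 + a₃ * α ^ 6 + a₄ * δ ^ 2 + 2 * lin α δ t₀ t₁ t₂ t₃ t₄ := by
  have hα : α ∈ A := (hA _).2 ⟨0, 1, 0, 0, 0, by simp [lin]⟩
  have hδ : δ ∈ A := (hA _).2 ⟨0, 0, 0, 0, 1, by simp [lin]⟩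
  have sq (a : ℤ) : ∃ e : ℤ, (a : K) ^ 2 = a + 2 * e := by
    obtain ⟨e, he⟩ := Int.even_mul_pred_self a
    have h : a ^ 2 = a + 2 * e := by linarith
    exact ⟨e, by exact_mod_cast congrArg (Int.cast (R := K)) h⟩
  obtain ⟨e₀, h₀⟩ := sq a₀
  obtain ⟨e₁, h₁⟩ := sq a₁
  obtain ⟨e₂, h₂⟩ := sq a₂
  obtain ⟨e₃, h₃⟩ := sq a₃
  obtain ⟨e₄, h₄⟩ := sq a₄
  have mem : (e₀ + e₁ * α ^ 2 + e₂ * α ^ 4 + e₃ * α ^ 6 + e₄ * δ ^ 2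
      + a₀ * (a₁ * α + a₂ * α ^ 2 + a₃ * α ^ 3 + a₄ * δ)
      + a₁ * α * (a₂ * α ^ 2 + a₃ * α ^ 3 + a₄ * δ)
      + a₂ * α ^ 2 * (a₃ * α ^ 3 + a₄ * δ) + a₃ * α ^ 3 * (a₄ * δ) : K) ∈ A := by
    repeat' first | apply add_mem | apply mul_mem | apply pow_mem
    all_goals first | assumption | exact intCast_mem _ _
  obtain ⟨t₀, t₁, t₂, t₃, t₄, ht⟩ := (hA _).1 mem
  refine ⟨t₀, t₁, t₂, t₃, t₄, ?_⟩
  rw [← ht]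
  simp only [lin]
  linear_combination h₀ + α ^ 2 * h₁ + α ^ 4 * h₂ + α ^ 6 * h₃ + δ ^ 2 * h₄

theorem lin_eq_two_mul {a₀ a₁ a₂ a₃ a₄ : ℤ} (h₀ : Even a₀) (h₁ : Even a₁) (h₂ : Even a₂)
    (h₃ : Even a₃) (h₄ : Even a₄) : ∃ b ∈ linSubgroup α δ, lin α δ a₀ a₁ a₂ a₃ a₄ = 2 * b := by
  obtain ⟨b₀, rfl⟩ := h₀
  obtain ⟨b₁, rfl⟩ := h₁
  obtain ⟨b₂, rfl⟩ := h₂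
  obtain ⟨b₃, rfl⟩ := h₃
  obtain ⟨b₄, rfl⟩ := h₄
  exact ⟨_, ⟨b₀, b₁, b₂, b₃, b₄, rfl⟩, by simp only [lin]; push_cast; ring⟩

theorem lin_injective [CharZero K] (hα : (minpoly ℚ α).natDegree = 5) {r₀ r₁ r₂ r₃ r₄ : ℚ}
    (hδ : δ = r₀ + r₁ * α + r₂ * α ^ 2 + r₃ * α ^ 3 + r₄ * α ^ 4) (hr : r₄ ≠ 0)
    {a₀ a₁ a₂ a₃ a₄ b₀ b₁ b₂ b₃ b₄ : ℤ}
    (h : lin α δ a₀ a₁ a₂ a₃ a₄ = lin α δ b₀ b₁ b₂ b₃ b₄) :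
    a₀ = b₀ ∧ a₁ = b₁ ∧ a₂ = b₂ ∧ a₃ = b₃ ∧ a₄ = b₄ := by
  obtain ⟨h₀, h₁, h₂, h₃, h₄⟩ := coeffs_eq_zero_of_natDegree_minpoly hα
    (q₀ := a₀ - b₀ + (a₄ - b₄) * r₀) (q₁ := a₁ - b₁ + (a₄ - b₄) * r₁)
    (q₂ := a₂ - b₂ + (a₄ - b₄) * r₂) (q₃ := a₃ - b₃ + (a₄ - b₄) * r₃) (q₄ := (a₄ - b₄) * r₄) (by
      simp only [lin, hδ] at h
      push_cast
      linear_combination h)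
  have e₄ : (a₄ : ℚ) - b₄ = 0 := (mul_eq_zero.1 h₄).resolve_right hr
  simp only [e₄, zero_mul, add_zero, sub_eq_zero, Int.cast_inj] at h₀ h₁ h₂ h₃
  exact ⟨h₀, h₁, h₂, h₃, by exact_mod_cast sub_eq_zero.1 e₄⟩

theorem isIntegral_lin (hα : IsIntegral ℤ α) (hδ : IsIntegral ℤ δ) {x : K}
    (hx : x ∈ linSubgroup α δ) : IsIntegral ℤ x := by
  obtain ⟨a₀, a₁, a₂, a₃, a₄, rfl⟩ := hx
  have int (n : ℤ) : IsIntegral ℤ (n : K) := isIntegral_algebraMap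
  exact ((((int _).add ((int _).mul hα)).add ((int _).mul (hα.pow 2))).add
    ((int _).mul (hα.pow 3))).add ((int _).mul hδ)

end lin

theorem exists_odd_mul_mem {K : Type*} [Field K] [CharZero K] (A : Subring K)
    (hA : ∀ x : K, IsIntegral ℤ x → 2 * x ∈ A → x ∈ A) {α : K} (hα : α ∈ A)
    (hgen : Algebra.adjoin ℚ {α} = ⊤) {x : K} (hx : IsIntegral ℤ x) :
    ∃ m : ℤ, Odd m ∧ m * x ∈ A := by
  obtain ⟨m, hm, p, hp⟩ := exists_int_mul_eq_aeval hgen x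
  have hmem : m * x ∈ A := by
    rw [hp, aeval_eq_sum_range]
    exact sum_mem fun i _ => zsmul_mem (pow_mem hα i) _
  obtain ⟨n, hmn, hn⟩ :=
    (Int.finiteMultiplicity_iff.2 ⟨by decide, hm⟩ :
      FiniteMultiplicity 2 m).exists_eq_pow_mul_and_not_dvd
  refine ⟨n, by rwa [← Int.not_even_iff_odd, even_iff_two_dvd], ?_⟩
  generalize multiplicity 2 m = j at hmn
  clear hp hm
  induction j generalizing m with
  | zero => simpa [hmn] using hmem
  | succ j ih =>
    refine ih (2 ^ j * n) (hA _ (((isIntegral_algebraMap (x := (2 ^ j * n : ℤ)))).mul hx) ?_) rfl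
    convert hmem using 1
    rw [hmn]
    push_cast
    ring

section quintic

variable {K : Type*} [Field K] {α β γ : K} {u k : ℤ}

theorem sq_lin_of_mod_four_eq_one [CharZero K] (hαβ : α * β = -12 * u) (hβ : 4 * β = α ^ 4 + 3 * α)
    (hu : Odd u) (A : Subring K) (hA : ∀ x, x ∈ A ↔ x ∈ linSubgroup α β) (a₀ a₁ a₂ a₃ a₄ : ℤ) :
    ∃ c₀ c₁ c₂ c₃ c₄ : ℤ, lin α β a₀ a₁ a₂ a₃ a₄ ^ 2 = lin α β c₀ c₁ c₂ c₃ c₄ ∧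
      Even (c₀ - (a₀ + a₄)) ∧ Even (c₁ - a₂) ∧ Even (c₂ - a₁) ∧ Even (c₃ - (a₃ + a₄)) ∧
      Even c₄ := by
  obtain ⟨t₀, t₁, t₂, t₃, t₄, ht⟩ := lin_sq A hA a₀ a₁ a₂ a₃ a₄
  refine ⟨a₀ - 9 * u * a₄ + 2 * t₀, -3 * a₂ - 48 * u * a₃ + 2 * t₁, a₁ + 2 * t₂,
    -3 * a₃ - 3 * u * a₄ + 2 * t₃, 4 * a₂ + 2 * t₄, ?_, ?_⟩
  · rw [ht]
    simp only [lin]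
    push_cast
    linear_combination (4 * a₃ * α + a₄ / 4 * (α ^ 3 + 3)) * hαβ
      - (a₂ + a₃ * α ^ 2 - a₄ / 4 * β) * hβ
  · obtain ⟨k, rfl⟩ := hu
    exact ⟨⟨-9 * k * a₄ - 5 * a₄ + t₀, by ring⟩, ⟨-2 * a₂ - 24 * (2 * k + 1) * a₃ + t₁, by ring⟩,
      ⟨t₂, by ring⟩, ⟨-2 * a₃ - 3 * k * a₄ - 2 * a₄ + t₃, by ring⟩, ⟨2 * a₂ + t₄, by ring⟩⟩

theorem sq_lin_of_mod_four_eq_three (hα : α ^ 4 = lin α γ (-12) (-3) 0 (-4) 8)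
    (hαγ : α * γ = lin α γ (-6 - 6 * u) 0 0 (-2) 4)
    (hγ : γ ^ 2 = lin α γ (-9 * k) (-12 * u) (-6 * u) (-3 * k) 3)
    (A : Subring K) (hA : ∀ x, x ∈ A ↔ x ∈ linSubgroup α γ) (a₀ a₁ a₂ a₃ a₄ : ℤ) :
    ∃ c₀ c₁ c₂ c₃ c₄ : ℤ, lin α γ a₀ a₁ a₂ a₃ a₄ ^ 2 = lin α γ c₀ c₁ c₂ c₃ c₄ ∧
      Even (c₀ - (a₀ + k * a₄)) ∧ Even (c₁ - a₂) ∧ Even (c₂ - a₁) ∧ Even (c₃ - (a₃ + k * a₄)) ∧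
      Even (c₄ - a₄) := by
  obtain ⟨t₀, t₁, t₂, t₃, t₄, ht⟩ := lin_sq A hA a₀ a₁ a₂ a₃ a₄
  refine ⟨a₀ - 12 * a₂ - 9 * k * a₄ + 2 * t₀, -3 * a₂ - 48 * u * a₃ - 12 * u * a₄ + 2 * t₁,
    a₁ - 6 * u * a₄ + 2 * t₂, -4 * a₂ - 3 * a₃ - 3 * k * a₄ + 2 * t₃,
    8 * a₂ + 3 * a₄ + 2 * t₄, ?_, ?_⟩
  · rw [ht]
    simp only [lin] at *
    push_cast at *
    linear_combination (a₂ + a₃ * α ^ 2 - 4 * a₃ * α) * hα + 8 * a₃ * α * hαγ + a₄ * hγ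
  · exact ⟨⟨-6 * a₂ - 5 * k * a₄ + t₀, by ring⟩, ⟨-2 * a₂ - 24 * u * a₃ - 6 * u * a₄ + t₁, by ring⟩,
      ⟨-3 * u * a₄ + t₂, by ring⟩, ⟨-2 * a₂ - 2 * a₃ - 2 * k * a₄ + t₃, by ring⟩,
      ⟨4 * a₂ + a₄ + t₄, by ring⟩⟩

end quintic

theorem even_of_lin_eq_two_mul {K : Type*} [Field K] [CharZero K] {α δ : K}
    (hα : (minpoly ℚ α).natDegree = 5) {r₀ r₁ r₂ r₃ r₄ : ℚ}
    (hδ : δ = r₀ + r₁ * α + r₂ * α ^ 2 + r₃ * α ^ 3 + r₄ * α ^ 4) (hr : r₄ ≠ 0)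
    {a₀ a₁ a₂ a₃ a₄ : ℤ} {b : K} (hb : b ∈ linSubgroup α δ)
    (h : lin α δ a₀ a₁ a₂ a₃ a₄ = 2 * b) : Even a₀ ∧ Even a₁ ∧ Even a₂ ∧ Even a₃ ∧ Even a₄ := by
  obtain ⟨b₀, b₁, b₂, b₃, b₄, rfl⟩ := hb
  obtain ⟨h₀, h₁, h₂, h₃, h₄⟩ := lin_injective hα hδ hr
    (b₀ := b₀ + b₀) (b₁ := b₁ + b₁) (b₂ := b₂ + b₂) (b₃ := b₃ + b₃) (b₄ := b₄ + b₄)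
    (h.trans (by simp only [lin]; push_cast; ring))
  exact ⟨⟨_, h₀⟩, ⟨_, h₁⟩, ⟨_, h₂⟩, ⟨_, h₃⟩, ⟨_, h₄⟩⟩

theorem odd_subIndex_of_even_coeffs {K : Type*} [Field K] [NumberField K]
    (hK : Module.finrank ℚ K = 5) (A : Subring K)
    (hA : ∀ x : K, IsIntegral ℤ x → 2 * x ∈ A → x ∈ A) {θ : 𝓞 K} (hθ : (θ : K) ∈ A)
    (heven : ∀ c₀ c₁ c₂ c₃ c₄ : ℤ, ∀ b ∈ A,
      (c₀ : K) + c₁ * θ + c₂ * (θ : K) ^ 2 + c₃ * (θ : K) ^ 3 + c₄ * (θ : K) ^ 4 = 2 * b →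
      Even c₀ ∧ Even c₁ ∧ Even c₂ ∧ Even c₃ ∧ Even c₄) :
    Algebra.adjoin ℚ {(θ : K)} = ⊤ ∧ ¬ 2 ∣ subIndex θ := by
  have hint : IsIntegral ℤ (θ : K) := θ.isIntegral_coe
  have hmin : minpoly ℚ (θ : K) = (minpoly ℤ (θ : K)).map (algebraMap ℤ ℚ) :=
    minpoly.isIntegrallyClosed_eq_field_fractions' ℚ hint
  have hmonic := minpoly.monic hint
  have htop : Algebra.adjoin ℚ {(θ : K)} = ⊤ := by
    rw [adjoin_eq_top_iff_natDegree_minpoly, hK]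
    refine le_antisymm (hK ▸ minpoly.natDegree_le _) ?_
    rw [hmin, hmonic.natDegree_map]
    by_contra! hlt
    have h0 := minpoly.aeval ℤ (θ : K)
    rw [aeval_eq_sum_range' hlt] at h0
    simp only [Finset.sum_range_succ, Finset.sum_range_zero, zsmul_eq_mul, pow_zero, mul_one,
      pow_one, zero_add] at h0
    obtain ⟨e₀, e₁, e₂, e₃, e₄⟩ := heven _ _ _ _ _ 0 A.zero_mem (h0.trans (mul_zero 2).symm)
    have hlead : (minpoly ℤ (θ : K)).coeff (minpoly ℤ (θ : K)).natDegree = 1 := hmonic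
    generalize (minpoly ℤ (θ : K)).natDegree = d at hlead hlt
    interval_cases d <;> simp_all
  refine ⟨htop, odd_subIndex_of_two_mul htop fun x hx => ?_⟩
  obtain ⟨c₀, c₁, c₂, c₃, c₄, hc⟩ := exists_coeffs_of_mem_adjoin hK hx
  have hcK : 2 * (x : K)
      = c₀ + c₁ * θ + c₂ * (θ : K) ^ 2 + c₃ * (θ : K) ^ 3 + c₄ * (θ : K) ^ 4 := by
    have h := congrArg (algebraMap (𝓞 K) K) hc
    simp only [map_mul, map_add, map_pow, map_intCast, map_ofNat] at h
    exact h
  have hxA : (x : K) ∈ A := by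
    refine hA _ x.isIntegral_coe ?_
    rw [hcK]
    repeat' first | apply add_mem | apply mul_mem | apply pow_mem
    all_goals first | assumption | exact intCast_mem _ _
  obtain ⟨⟨b₀, rfl⟩, ⟨b₁, rfl⟩, ⟨b₂, rfl⟩, ⟨b₃, rfl⟩, ⟨b₄, rfl⟩⟩ :=
    heven c₀ c₁ c₂ c₃ c₄ _ hxA hcK.symm
  have hxθ : x = b₀ + b₁ * θ + b₂ * θ ^ 2 + b₃ * θ ^ 3 + b₄ * θ ^ 4 := by
    apply mul_left_cancel₀ (two_ne_zero (α := 𝓞 K))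
    rw [hc]
    push_cast
    ring
  have hθmem := Algebra.self_mem_adjoin_singleton ℤ θ
  rw [hxθ]
  repeat' first | apply add_mem | apply mul_mem | apply pow_mem
  all_goals first | assumption | exact intCast_mem _ _

section modFourEqOne

variable {K : Type*} [Field K] [CharZero K] {α β : K} {u k : ℤ}

theorem even_of_two_mul_eq_lin (hdeg : (minpoly ℚ α).natDegree = 5) (hαβ : α * β = -12 * u)
    (hβ : 4 * β = α ^ 4 + 3 * α) (hu : Odd u) (A : Subring K)
    (hA : ∀ x, x ∈ A ↔ x ∈ linSubgroup α β) {x : K} (hx : IsIntegral ℤ x)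
    {a₀ a₁ a₂ a₃ a₄ : ℤ} (h : 2 * x = lin α β a₀ a₁ a₂ a₃ a₄) :
    Even a₁ ∧ Even a₂ ∧ Even (a₀ + a₄) ∧ Even (a₃ + a₄) := by
  have hβlin : β = ((0 : ℚ) : K) + ((3 / 4 : ℚ) : K) * α + ((0 : ℚ) : K) * α ^ 2
      + ((0 : ℚ) : K) * α ^ 3 + ((1 / 4 : ℚ) : K) * α ^ 4 := by
    push_cast; linear_combination hβ / 4
  have hr : (1 / 4 : ℚ) ≠ 0 := by norm_num
  let P (y : K) : Prop := ∃ b₀ b₁ b₂ b₃ b₄ : ℤ, y = lin α β b₀ b₁ b₂ b₃ b₄ ∧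
    Even b₁ ∧ Even b₂ ∧ Even (b₀ + b₄) ∧ Even (b₃ + b₄)
  have two_mul (a : K) (ha : a ∈ A) : P (2 * a) := by
    obtain ⟨b₀, b₁, b₂, b₃, b₄, rfl⟩ := (hA a).1 ha
    refine ⟨2 * b₀, 2 * b₁, 2 * b₂, 2 * b₃, 2 * b₄, ?_, even_two_mul _, even_two_mul _,
      (even_two_mul _).add (even_two_mul _), (even_two_mul _).add (even_two_mul _)⟩
    simp only [lin]; push_cast; ring
  have of_sq (a : K) (ha : a ∈ A) (hP : P (a ^ 2)) : P a := by
    obtain ⟨b₀, b₁, b₂, b₃, b₄, hb, hev⟩ := hP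
    obtain ⟨a₀, a₁, a₂, a₃, a₄, rfl⟩ := (hA a).1 ha
    obtain ⟨c₀, c₁, c₂, c₃, c₄, hc, hcev⟩ :=
      sq_lin_of_mod_four_eq_one hαβ hβ hu A hA a₀ a₁ a₂ a₃ a₄
    obtain ⟨rfl, rfl, rfl, rfl, rfl⟩ := lin_injective hdeg hβlin hr (hc.symm.trans hb)
    obtain ⟨f₁, f₂, f₀, f₃⟩ := hev
    obtain ⟨e₀, e₁, e₂, e₃, e₄⟩ := hcev
    exact ⟨_, _, _, _, _, rfl, (Int.even_sub.1 e₂).1 f₂, (Int.even_sub.1 e₁).1 f₁,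
      (Int.even_sub.1 e₀).1 ((Int.even_add.1 f₀).2 e₄),
      (Int.even_sub.1 e₃).1 ((Int.even_add.1 f₃).2 e₄)⟩
  obtain ⟨b₀, b₁, b₂, b₃, b₄, hb, hev⟩ :=
    two_mul_mem_of_sq_mem A {y | P y} two_mul of_sq hx ((hA _).2 ⟨_, _, _, _, _, h⟩)
  obtain ⟨rfl, rfl, rfl, rfl, rfl⟩ := lin_injective hdeg hβlin hr (h.symm.trans hb)
  exact hev

theorem mem_of_two_mul_mem_of_mod_four_eq_one (hdeg : (minpoly ℚ α).natDegree = 5)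
    (hα : IsIntegral ℤ α) (hβint : IsIntegral ℤ β) (hαβ : α * β = -12 * u)
    (hβ : 4 * β = α ^ 4 + 3 * α) (hu : u = 4 * k + 1) (A : Subring K)
    (hA : ∀ x, x ∈ A ↔ x ∈ linSubgroup α β) {x : K} (hx : IsIntegral ℤ x) (h : 2 * x ∈ A) :
    x ∈ A := by
  have hodd : Odd u := ⟨2 * k, by rw [hu]; ring⟩
  obtain ⟨a₀, a₁, a₂, a₃, a₄, ha⟩ := (hA _).1 h
  obtain ⟨⟨b₁, rfl⟩, ⟨b₂, rfl⟩, ⟨b₀, h₀⟩, ⟨b₃, h₃⟩⟩ :=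
    even_of_two_mul_eq_lin hdeg hαβ hβ hodd A hA hx ha
  obtain ⟨b₄, rfl | rfl⟩ := Int.even_or_odd' a₄
  · refine (hA _).2 ⟨b₀ - b₄, b₁, b₂, b₃ - b₄, b₄, ?_⟩
    obtain rfl : a₀ = 2 * b₀ - 2 * b₄ := by linarith
    obtain rfl : a₃ = 2 * b₃ - 2 * b₄ := by linarith
    apply mul_left_cancel₀ (two_ne_zero (α := K))
    rw [ha]
    simp only [lin]; push_cast; ring
  · exfalso
    obtain rfl : a₀ = 2 * b₀ - 2 * b₄ - 1 := by linarith
    obtain rfl : a₃ = 2 * b₃ - 2 * b₄ - 1 := by linarith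
    have hγ : IsIntegral ℤ ((β + α ^ 3 + 3) / 2) := by
      have := hx.sub (isIntegral_lin hα hβint ⟨b₀ - b₄ - 2, b₁, b₂, b₃ - b₄ - 1, b₄, rfl⟩)
      refine (congrArg (IsIntegral ℤ) ?_).mp this
      apply mul_left_cancel₀ (two_ne_zero (α := K))
      rw [mul_sub, ha]
      simp only [lin]; push_cast; ring
    have hβ' : IsIntegral ℤ (β / 2) := by
      have int : IsIntegral ℤ ((6 * k : ℤ) : K) := isIntegral_algebraMap
      have := (hγ.pow 2).add ((int.mul hγ).add (isIntegral_lin hα hβint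
        ⟨0, 12 * u, 6 * u, 0, -(3 * k + 1), rfl⟩))
      refine (congrArg (IsIntegral ℤ) ?_).mpr this
      simp only [lin, hu] at hαβ ⊢
      push_cast at hαβ ⊢
      linear_combination (α ^ 2 / 4 - β / 16) * hβ - (α ^ 2 / 2 + α + (α ^ 3 + 3) / 16) * hαβ
    have := (even_of_two_mul_eq_lin hdeg hαβ hβ hodd A hA hβ'
      (a₀ := 0) (a₁ := 0) (a₂ := 0) (a₃ := 0) (a₄ := 1)
      (by simp only [lin]; push_cast; ring)).2.2.1
    simp at this

end modFourEqOne

theorem exists_odd_subIndex {K : Type*} [Field K] [NumberField K] {α : K} {u k : ℤ}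
    (hdeg : (minpoly ℚ α).natDegree = 5) (hK : Module.finrank ℚ K = 5) (hα : IsIntegral ℤ α)
    (hroot : α ^ 5 + 3 * α ^ 2 + 48 * u = 0) (hu : u = 4 * k + 1) :
    ∃ θ : 𝓞 K, Algebra.adjoin ℚ {(θ : K)} = ⊤ ∧ ¬ 2 ∣ subIndex θ := by
  obtain ⟨β, hβ⟩ : ∃ β : K, 4 * β = α ^ 4 + 3 * α := ⟨(α ^ 4 + 3 * α) / 4, by ring⟩
  have hαβ : α * β = -12 * u := by linear_combination α / 4 * hβ + hroot / 4
  have hβ2 : β ^ 2 = ((-9 * u : ℤ) : K) + ((-3 * u : ℤ) : K) * α ^ 3 := by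
    push_cast
    linear_combination β / 4 * hβ + (α ^ 3 + 3) / 4 * hαβ
  have hβint : IsIntegral ℤ β := by
    have int (n : ℤ) : IsIntegral ℤ (n : K) := isIntegral_algebraMap
    exact IsIntegral.of_pow two_pos (hβ2 ▸ (int _).add ((int _).mul (hα.pow 3)))
  have hβlin : β = ((0 : ℚ) : K) + ((3 / 4 : ℚ) : K) * α + ((0 : ℚ) : K) * α ^ 2
      + ((0 : ℚ) : K) * α ^ 3 + ((1 / 4 : ℚ) : K) * α ^ 4 := by
    push_cast; linear_combination hβ / 4
  have hodd : Odd u := ⟨2 * k, by rw [hu]; ring⟩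
  obtain ⟨A, hA⟩ : ∃ A : Subring K, ∀ x, x ∈ A ↔ x ∈ linSubgroup α β :=
    ⟨linSubring α β ⟨0, -3, 0, 0, 4, by simp only [lin]; push_cast; linear_combination -hβ⟩
      ⟨-12 * u, 0, 0, 0, 0, by rw [hαβ]; simp [lin]⟩
      ⟨-9 * u, 0, 0, -3 * u, 0, by rw [hβ2]; simp [lin]⟩, fun _ => Iff.rfl⟩
  obtain ⟨θ, hθ⟩ : ∃ θ : 𝓞 K, (θ : K) = lin α β 3 1 0 1 1 :=
    ⟨⟨_, isIntegral_lin hα hβint ⟨3, 1, 0, 1, 1, rfl⟩⟩, rfl⟩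
  have hθA : (θ : K) ∈ A := (hA _).2 ⟨_, _, _, _, _, hθ⟩
  have hαA : α ∈ A := (hA _).2 ⟨0, 1, 0, 0, 0, by simp [lin]⟩
  have hβA : β ∈ A := (hA _).2 ⟨0, 0, 0, 0, 1, by simp [lin]⟩
  obtain ⟨w, hw, hθ2⟩ : ∃ w ∈ A, (θ : K) ^ 2 = α ^ 2 + 2 * w := by
    obtain ⟨c₀, c₁, c₂, c₃, c₄, hc, e₀, e₁, e₂, e₃, e₄⟩ :=
      sq_lin_of_mod_four_eq_one hαβ hβ hodd A hA 3 1 0 1 1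
    obtain ⟨w, hw, h⟩ := lin_eq_two_mul (α := α) (δ := β)
      (e₀.add (by decide : Even (3 + 1 : ℤ))) e₁ e₂ (e₃.add (by decide : Even (1 + 1 : ℤ))) e₄
    refine ⟨w, (hA w).2 hw, ?_⟩
    rw [hθ, hc, ← h]
    simp only [lin]; push_cast; ring
  refine ⟨θ, odd_subIndex_of_even_coeffs hK A (fun x hx h =>
    mem_of_two_mul_mem_of_mod_four_eq_one hdeg hα hβint hαβ hβ hu A hA hx h) hθA ?_⟩
  intro c₀ c₁ c₂ c₃ c₄ b hb hc
  have mem : b - (c₂ * w + c₃ * (θ * w)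
      + c₄ * ((2 : ℤ) * β - (2 : ℤ) * α + (2 : ℤ) * (α ^ 2 * w) + (2 : ℤ) * w ^ 2)) ∈ A := by
    repeat' first | apply add_mem | apply sub_mem | apply mul_mem | apply pow_mem
    all_goals first | assumption | exact intCast_mem _ _
  obtain ⟨e₀, e₁, e₂, e₃, e₄⟩ := even_of_lin_eq_two_mul hdeg hβlin (by norm_num)
    (a₀ := c₀ + 3 * c₁ - 48 * u * c₃) (a₁ := c₁ + c₄ - 12 * u * c₃) (a₂ := c₂) (a₃ := c₁ + c₃)
    (a₄ := c₁) ((hA _).1 mem) (by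
      simp only [lin] at hθ ⊢
      push_cast at hθ ⊢
      linear_combination hc - (c₂ + c₃ * θ + c₄ * (θ ^ 2 + α ^ 2 + 2 * w)) * hθ2
        - (c₁ + c₃ * α ^ 2) * hθ - c₃ * (hroot + α * hαβ) + c₄ * hβ)
  have h48 : Even (48 * u * c₃) := ⟨24 * u * c₃, by ring⟩
  have h12 : Even (12 * u * c₃) := ⟨6 * u * c₃, by ring⟩
  simp only [Int.even_add, Int.even_sub, Int.even_mul (m := 3), e₄, h48, h12] at e₀ e₁ e₃
  have h3 : Even (3 * c₁) := e₄.mul_left 3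
  simp_all

theorem isCommonIndexDivisor_two {K : Type*} [Field K] [NumberField K] {α : K} {u k : ℤ}
    (hgen : Algebra.adjoin ℚ {α} = ⊤) (hK : Module.finrank ℚ K = 5) (hα : IsIntegral ℤ α)
    (hroot : α ^ 5 + 3 * α ^ 2 + 48 * u = 0) (hu : u = 4 * k - 1) :
    IsCommonIndexDivisor 2 K := by
  have hdeg := ((adjoin_eq_top_iff_natDegree_minpoly α).1 hgen).trans hK
  obtain ⟨β, hβ⟩ : ∃ β : K, 4 * β = α ^ 4 + 3 * α := ⟨(α ^ 4 + 3 * α) / 4, by ring⟩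
  obtain ⟨γ, hγ⟩ : ∃ γ : K, 2 * γ = β + α ^ 3 + 3 := ⟨(β + α ^ 3 + 3) / 2, by ring⟩
  have hαβ : α * β = -12 * u := by linear_combination α / 4 * hβ + hroot / 4
  have hβ2 : β ^ 2 = -9 * u - 3 * u * α ^ 3 := by
    linear_combination β / 4 * hβ + (α ^ 3 + 3) / 4 * hαβ
  have huK : (u : K) = 4 * k - 1 := by exact_mod_cast congrArg (Int.cast (R := K)) hu
  have hα4 : α ^ 4 = lin α γ (-12) (-3) 0 (-4) 8 := by
    simp only [lin]; push_cast; linear_combination -hβ - 4 * hγ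
  have hαγ : α * γ = lin α γ (-6 - 6 * u) 0 0 (-2) 4 := by
    simp only [lin]; push_cast; linear_combination (α * hγ + hαβ - hβ - 4 * hγ) / 2
  have hγ2 : γ ^ 2 = lin α γ (-9 * k) (-12 * u) (-6 * u) (-3 * k) 3 := by
    simp only [lin]; push_cast
    linear_combination ((2 * γ + β + α ^ 3 + 3) * hγ + hβ2 + α * hroot + 2 * α ^ 2 * hαβ
      - 6 * hγ - (9 + 3 * α ^ 3) * huK) / 4
  have hγint : IsIntegral ℤ γ := by
    refine IsIntegral.of_aeval_monic (p := X ^ 2 - 3 * X) (by monicity!) ?_ ?_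
    · rw [show (X ^ 2 - 3 * X : ℤ[X]).natDegree = 2 by compute_degree!]
      decide
    refine (congrArg (IsIntegral ℤ) ?_).mpr (isIntegral_lin hα hα
      ⟨-9 * k, -12 * u, -6 * u, -3 * k, 0, rfl⟩)
    simp only [map_sub, map_mul, map_pow, aeval_X, map_ofNat, hγ2, lin]
    push_cast
    ring
  have hγlin : γ = ((3 / 2 : ℚ) : K) + ((3 / 8 : ℚ) : K) * α + ((0 : ℚ) : K) * α ^ 2
      + ((1 / 2 : ℚ) : K) * α ^ 3 + ((1 / 8 : ℚ) : K) * α ^ 4 := by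
    push_cast; linear_combination hγ / 2 + hβ / 8
  obtain ⟨A, hA⟩ : ∃ A : Subring K, ∀ x, x ∈ A ↔ x ∈ linSubgroup α γ :=
    ⟨linSubring α γ ⟨_, _, _, _, _, hα4⟩ ⟨_, _, _, _, _, hαγ⟩ ⟨_, _, _, _, _, hγ2⟩,
      fun _ => Iff.rfl⟩
  have hαA : α ∈ A := (hA _).2 ⟨0, 1, 0, 0, 0, by simp [lin]⟩
  have maximal (x : K) (hx : IsIntegral ℤ x) (h : 2 * x ∈ A) : x ∈ A := by
    obtain ⟨b, hb, hxb⟩ := two_mul_mem_of_sq_mem A {y | ∃ b ∈ A, y = 2 * b}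
      (fun a ha => ⟨a, ha, rfl⟩) (fun a ha ⟨b, hb, hab⟩ => by
        obtain ⟨a₀, a₁, a₂, a₃, a₄, rfl⟩ := (hA a).1 ha
        obtain ⟨c₀, c₁, c₂, c₃, c₄, hc, e₀, e₁, e₂, e₃, e₄⟩ :=
          sq_lin_of_mod_four_eq_three hα4 hαγ hγ2 A hA a₀ a₁ a₂ a₃ a₄
        obtain ⟨f₀, f₁, f₂, f₃, f₄⟩ := even_of_lin_eq_two_mul hdeg hγlin (by norm_num)
          ((hA _).1 hb) (hc.symm.trans hab)
        have g₄ := (Int.even_sub.1 e₄).1 f₄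
        have hk := g₄.mul_left k
        obtain ⟨b, hb, h⟩ := lin_eq_two_mul (α := α) (δ := γ)
          ((Int.even_add.1 ((Int.even_sub.1 e₀).1 f₀)).2 hk) ((Int.even_sub.1 e₂).1 f₂)
          ((Int.even_sub.1 e₁).1 f₁) ((Int.even_add.1 ((Int.even_sub.1 e₃).1 f₃)).2 hk) g₄
        exact ⟨b, (hA b).2 hb, h⟩) hx h
    rwa [mul_left_cancel₀ two_ne_zero hxb]
  have pow_four (a : K) (ha : a ∈ A) : ∃ b ∈ A, a ^ 4 - a = 2 * b := by
    obtain ⟨a₀, a₁, a₂, a₃, a₄, rfl⟩ := (hA a).1 ha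
    obtain ⟨c₀, c₁, c₂, c₃, c₄, hc, e₀, e₁, e₂, e₃, e₄⟩ :=
      sq_lin_of_mod_four_eq_three hα4 hαγ hγ2 A hA a₀ a₁ a₂ a₃ a₄
    obtain ⟨d₀, d₁, d₂, d₃, d₄, hd, f₀, f₁, f₂, f₃, f₄⟩ :=
      sq_lin_of_mod_four_eq_three hα4 hαγ hγ2 A hA c₀ c₁ c₂ c₃ c₄
    have g₄ : Even (k * (c₄ - a₄) + 2 * (k * a₄)) := (e₄.mul_left k).add (even_two_mul _)
    obtain ⟨b, hb, h⟩ := lin_eq_two_mul (α := α) (δ := γ) ((f₀.add e₀).add g₄) (f₁.add e₂)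
      (f₂.add e₁) ((f₃.add e₃).add g₄) (f₄.add e₄)
    refine ⟨b, (hA b).2 hb, ?_⟩
    rw [← h, show ∀ y : K, y ^ 4 = (y ^ 2) ^ 2 by intro y; ring, hc, hd]
    simp only [lin]; push_cast; ring
  intro θ hθ
  by_contra hodd
  obtain ⟨m, hm, hmθ⟩ := exists_odd_mul_mem A maximal hαA hgen θ.isIntegral_coe
  obtain ⟨b, hb, hmb⟩ := pow_four _ hmθ
  obtain ⟨b, rfl⟩ : ∃ b' : 𝓞 K, (b' : K) = b :=
    ⟨⟨b, isIntegral_lin hα hγint ((hA b).1 hb)⟩, rfl⟩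
  obtain ⟨c₀, c₁, c₂, c₃, c₄, hc⟩ := exists_coeffs_of_mem_adjoin hK (subIndex_mul_mem θ b)
  have hcK := congrArg (algebraMap (𝓞 K) K) hc
  simp only [map_mul, map_add, map_pow, map_intCast, map_natCast] at hcK
  obtain ⟨-, -, -, -, h⟩ := coeffs_eq_zero_of_natDegree_minpoly
    (((adjoin_eq_top_iff_natDegree_minpoly (θ : K)).1 hθ).trans hK)
    (q₀ := -2 * c₀) (q₁ := -subIndex θ * m - 2 * c₁) (q₂ := -2 * c₂) (q₃ := -2 * c₃)
    (q₄ := subIndex θ * m ^ 4 - 2 * c₄) (by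
      push_cast
      linear_combination (subIndex θ : K) * hmb + 2 * hcK)
  have h' : (subIndex θ : ℤ) * m ^ 4 = 2 * c₄ := by exact_mod_cast sub_eq_zero.1 h
  have hn : Odd (subIndex θ : ℤ) := by
    rw [Int.odd_coe_nat, ← Nat.not_even_iff_odd, even_iff_two_dvd]; exact hodd
  exact Int.not_even_iff_odd.2 (hn.mul (hm.pow (n := 4))) (h' ▸ even_two_mul c₄)

theorem stmt_19 (u : ℤ) (hu : Odd u) (hu3 : ¬ (3 : ℤ) ∣ u)
    (hirr : Irreducible (X ^ 5 + C (3 : ℚ) * X ^ 2 + C ((48 * u : ℤ) : ℚ)))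
    (K : Type*) [Field K] [NumberField K] (α : K)
    (hroot : α ^ 5 + 3 * α ^ 2 + ((48 * u : ℤ) : K) = 0)
    (hgen : Algebra.adjoin ℚ ({α} : Set K) = ⊤) :
    IsCommonIndexDivisor 2 K ↔ u % 4 = 3 := by
  have hmonic : (X ^ 5 + C (3 : ℚ) * X ^ 2 + C ((48 * u : ℤ) : ℚ)).Monic := by monicity!
  have hmin := minpoly.eq_of_irreducible_of_monic hirr (x := α) (by simpa using hroot) hmonic
  have hdeg : (minpoly ℚ α).natDegree = 5 := by rw [← hmin]; compute_degree!
  have hK := ((adjoin_eq_top_iff_natDegree_minpoly α).1 hgen).symm.trans hdeg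
  have hα : IsIntegral ℤ α :=
    ⟨X ^ 5 + C 3 * X ^ 2 + C (48 * u), by monicity!, by
      rw [← aeval_def]; simpa [map_ofNat (aeval α)] using hroot⟩
  have hroot' : α ^ 5 + 3 * α ^ 2 + 48 * u = 0 := by simpa using hroot
  constructor
  · intro h
    by_contra hne
    obtain ⟨k, hk⟩ : ∃ k, u = 4 * k + 1 := ⟨u / 4, by have := Int.odd_iff.1 hu; omega⟩
    obtain ⟨θ, hθ, hθ'⟩ := exists_odd_subIndex hdeg hK hα hroot' hk
    exact hθ' (h θ hθ)
  · intro h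
    exact isCommonIndexDivisor_two hgen hK hα hroot' (k := u / 4 + 1) (by omega)
end
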